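/- arXiv:1801.04845 — 8 statements merged into one kernel-verified Lean document; each statement's English description precedes it below -/
import Mathlib

section
/- Let d, a, m be integers with d ≥ 3, 0 ≤ a ≤ d−1, and m ≥ d. Then −6(a+1)m² − 3(d² − 2(2a+3)d + 6(a+1))m + 2(d−1)(d−2)(d − 3(a+1)) < 0. (Equivalently, the quantity P(d,a,m) = −2(a+1)m² − (d² − 2(2a+3)d + 6(a+1))m + (2/3)(d−1)(d−2)(d − 3(a+1)), which bounds the Hilbert–Mumford index μ_m(I,λ) from above in the paper's instability proof, is strictly negative for all such d, a, m.) -/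
/-- The key numerical estimate in the proof that non-complete-intersection points of
`Hilb_{(2,d)}` are GIT-unstable (rank-2 quadric case): for integers `d ≥ 3`,
`0 ≤ a ≤ d - 1`, `m ≥ d`, the (tripled) bound `3 · P(d,a,m)` on the Hilbert–Mumford
index is strictly negative. -/
theorem stmt0 (d a m : ℤ) (hd : 3 ≤ d) (ha0 : 0 ≤ a) (ha : a ≤ d - 1) (hm : d ≤ m) :
    -6 * (a + 1) * m ^ 2 - 3 * (d ^ 2 - 2 * (2 * a + 3) * d + 6 * (a + 1)) * m
      + 2 * (d - 1) * (d - 2) * (d - 3 * (a + 1)) < 0 := by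
  obtain ⟨s, rfl⟩ : ∃ s, d = 3 + s := ⟨d - 3, by ring⟩
  obtain ⟨t, rfl⟩ : ∃ t, m = 3 + s + t := ⟨m - (3 + s), by ring⟩
  have hs : 0 ≤ s := by linarith
  have ht : 0 ≤ t := by linarith
  have key : 0 < (15 + 23 * s + 9 * s ^ 2 + s ^ 3) + 12 * (a + 1)
      + (9 + 12 * s + 3 * s ^ 2 + 18 * (a + 1)) * t + 6 * (a + 1) * t ^ 2 := by positivity
  linear_combination key
end

section
/- Let ℤ⁴ carry the symmetric bilinear form with Gram matrix the orthogonal direct sum of two hyperbolic planes [[0,1],[1,0]] ⊕ [[0,1],[1,0]]. Then the isometry group O(U⊕U) acts transitively on the set of rank-2 saturated isotropic submodules: for any two submodules J₁, J₂ ⊆ ℤ⁴ of rank 2 such that the bilinear form vanishes identically on each Jᵣ and each quotient ℤ⁴/Jᵣ is torsion-free, there exists a ℤ-linear automorphism g of ℤ⁴ preserving the bilinear form with g(J₁) = J₂. -/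
/-- The hyperbolic form of `U ⊕ U` on `ℤ⁴`. -/
def bUU (x y : Fin 4 → ℤ) : ℤ :=
  x 0 * y 1 + x 1 * y 0 + x 2 * y 3 + x 3 * y 2

theorem uu_dual (f : (Fin 4 → ℤ) →ₗ[ℤ] ℤ) : ∃ u, ∀ x, bUU x u = f x := by
  refine ⟨![f (Pi.single 1 1), f (Pi.single 0 1), f (Pi.single 3 1), f (Pi.single 2 1)], ?_⟩
  intro x
  have hx : x = x 0 • Pi.single 0 1 + x 1 • Pi.single 1 1 + x 2 • Pi.single 2 1
      + x 3 • Pi.single 3 1 := by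
    ext i
    fin_cases i <;> simp
  conv_rhs => rw [hx]
  simp only [map_add, map_smul, bUU, smul_eq_mul]
  simp

theorem uu_functionals (J : Submodule ℤ (Fin 4 → ℤ))
    (hrk : Module.finrank ℤ J = 2)
    (hsat : ∀ (x : Fin 4 → ℤ) (c : ℤ), c ≠ 0 → c • x ∈ J → x ∈ J) :
    ∃ (e₁ e₂ : Fin 4 → ℤ) (f₁ f₂ : (Fin 4 → ℤ) →ₗ[ℤ] ℤ), e₁ ∈ J ∧ e₂ ∈ J ∧
      (∀ x ∈ J, ∃ a b : ℤ, x = a • e₁ + b • e₂) ∧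
      f₁ e₁ = 1 ∧ f₁ e₂ = 0 ∧ f₂ e₁ = 0 ∧ f₂ e₂ = 1 := by
  have : Module.IsTorsionFree ℤ ((Fin 4 → ℤ) ⧸ J) := by
    refine Module.IsTorsionFree.of_smul_eq_zero ?_
    intro c y h
    obtain ⟨x, rfl⟩ := J.mkQ_surjective y
    by_cases hc : c = 0
    · exact Or.inl hc
    · right
      rw [← map_smul] at h
      simp only [Submodule.mkQ_apply, Submodule.Quotient.mk_eq_zero] at h ⊢
      exact hsat x c hc h
  have : Module.Free ℤ ((Fin 4 → ℤ) ⧸ J) := inferInstance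
  obtain ⟨s, hs⟩ := Module.projective_lifting_property J.mkQ LinearMap.id J.mkQ_surjective
  let p : (Fin 4 → ℤ) →ₗ[ℤ] J := LinearMap.codRestrict J (LinearMap.id - s ∘ₗ J.mkQ) (by
    intro x
    rw [← Submodule.Quotient.mk_eq_zero, ← Submodule.mkQ_apply]
    have := LinearMap.congr_fun hs (J.mkQ x)
    simp only [LinearMap.comp_apply, LinearMap.id_apply] at this
    simp only [LinearMap.sub_apply, LinearMap.comp_apply, LinearMap.id_apply, map_sub]
    rw [this, sub_self])
  have hp : ∀ x : J, p x = x := by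
    intro x
    apply Subtype.ext
    have : J.mkQ (x : Fin 4 → ℤ) = 0 := by simp
    simp only [p, LinearMap.codRestrict_apply, LinearMap.sub_apply, LinearMap.comp_apply,
      LinearMap.id_apply, this, map_zero, sub_zero]
  let b := Module.finBasisOfFinrankEq ℤ J hrk
  refine ⟨b 0, b 1, b.coord 0 ∘ₗ p, b.coord 1 ∘ₗ p, (b 0).2, (b 1).2, ?_, ?_, ?_, ?_, ?_⟩
  · intro x hx
    refine ⟨b.repr ⟨x, hx⟩ 0, b.repr ⟨x, hx⟩ 1, ?_⟩
    have := congrArg Subtype.val (b.sum_repr ⟨x, hx⟩)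
    rw [Fin.sum_univ_two] at this
    exact this.symm
  all_goals simp [hp]

theorem uu_hyp (J : Submodule ℤ (Fin 4 → ℤ))
    (hrk : Module.finrank ℤ J = 2)
    (hiso : ∀ x ∈ J, ∀ y ∈ J, bUU x y = 0)
    (hsat : ∀ (x : Fin 4 → ℤ) (c : ℤ), c ≠ 0 → c • x ∈ J → x ∈ J) :
    ∃ g : (Fin 4 → ℤ) ≃ₗ[ℤ] (Fin 4 → ℤ),
      (∀ x y, bUU (g x) (g y) = bUU x y) ∧ ∀ x, g x ∈ J ↔ x 1 = 0 ∧ x 3 = 0 := by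
  obtain ⟨e, e', f, f', he, he', hJ, h1, h2, h3, h4⟩ := uu_functionals J hrk hsat
  obtain ⟨v, hv⟩ := uu_dual f
  obtain ⟨v', hv'⟩ := uu_dual f'
  rw [← hv] at h1 h2
  rw [← hv'] at h3 h4
  have add_l : ∀ x y z, bUU (x + y) z = bUU x z + bUU y z := by
    intro x y z; simp [bUU]; ring
  have smul_l : ∀ (c : ℤ) x z, bUU (c • x) z = c * bUU x z := by
    intro c x z; simp [bUU]; ring
  have add_r : ∀ x y z, bUU z (x + y) = bUU z x + bUU z y := by
    intro x y z; simp [bUU]; ring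
  have smul_r : ∀ (c : ℤ) x z, bUU z (c • x) = c * bUU z x := by
    intro c x z; simp [bUU]; ring
  have symm : ∀ x y, bUU x y = bUU y x := by
    intro x y; simp [bUU]; ring
  have i1 := hiso e he e he
  have i2 := hiso e he e' he'
  have i3 := hiso e' he' e' he'
  have i2' := hiso e' he' e he
  obtain ⟨q, hq⟩ : ∃ q, bUU v v = 2 * q := ⟨v 0 * v 1 + v 2 * v 3, by simp [bUU]; ring⟩
  obtain ⟨q', hq'⟩ : ∃ q, bUU v' v' = 2 * q := ⟨v' 0 * v' 1 + v' 2 * v' 3, by simp [bUU]; ring⟩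
  have h1' := symm v e
  have h2' := symm v e'
  have h3' := symm v' e
  have h4' := symm v' e'
  have h5' := symm v' v
  obtain ⟨u, hu⟩ : ∃ u, u = v + (-q) • e := ⟨_, rfl⟩
  obtain ⟨u', hu'⟩ : ∃ u', u' = v' + (-bUU v v') • e + (-q') • e' := ⟨_, rfl⟩
  have a1 : bUU e u = 1 := by rw [hu]; simp only [add_r, smul_r, h1, h2, h3, h4, i1, i2, i2', i3]; ring
  have a2 : bUU e' u = 0 := by rw [hu]; simp only [add_r, smul_r, h1, h2, h3, h4, i1, i2, i2', i3]; ring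
  have a3 : bUU e u' = 0 := by rw [hu']; simp only [add_r, smul_r, h1, h2, h3, h4, i1, i2, i2', i3]; ring
  have a4 : bUU e' u' = 1 := by rw [hu']; simp only [add_r, smul_r, h1, h2, h3, h4, i1, i2, i2', i3]; ring
  have a5 : bUU u u = 0 := by
    rw [hu]; simp only [add_l, add_r, smul_l, smul_r, h1', h1, i1, hq]; ring
  have a6 : bUU u u' = 0 := by
    rw [hu, hu']; simp only [add_l, add_r, smul_l, smul_r, h1', h1, h2', h2, h3, i1, i2]; ring
  have a7 : bUU u' u' = 0 := by
    rw [hu']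
    simp only [add_l, add_r, smul_l, smul_r, h3', h4', h3, h4, i1, i2, i2', i3, hq']; ring
  have b1 := (symm u e).trans a1
  have b2 := (symm u e').trans a2
  have b3 := (symm u' e).trans a3
  have b4 := (symm u' e').trans a4
  have b6 := (symm u' u).trans a6
  clear hu hu' h1 h2 h3 h4 h1' h2' h3' h4' h5' hq hq'
  let G : (Fin 4 → ℤ) →ₗ[ℤ] (Fin 4 → ℤ) :=
    { toFun := fun x => x 0 • e + x 1 • u + x 2 • e' + x 3 • u'
      map_add' := by intro x y; simp only [Pi.add_apply]; module
      map_smul' := by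
        intro c x; simp only [Pi.smul_apply, smul_eq_mul, RingHom.id_apply]; module }
  let H : (Fin 4 → ℤ) →ₗ[ℤ] (Fin 4 → ℤ) :=
    { toFun := fun x => ![bUU x u, bUU x e, bUU x u', bUU x e']
      map_add' := by intro x y; ext i; fin_cases i <;> simp [add_l]
      map_smul' := by intro c x; ext i; simp only [smul_l]; fin_cases i <;> simp }
  have hG : ∀ x, G x = x 0 • e + x 1 • u + x 2 • e' + x 3 • u' := fun _ => rfl
  have hH : ∀ x, H x = ![bUU x u, bUU x e, bUU x u', bUU x e'] := fun _ => rfl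
  have hHG : H * G = 1 := by
    apply LinearMap.ext
    intro x
    rw [Module.End.mul_apply, hH, hG]
    ext i
    simp only [add_l, smul_l, a1, a2, a3, a4, a5, a6, a7, b1, b2, b3, b4, b6, i1, i2, i2', i3]
    fin_cases i <;> simp
  have hGH : G * H = 1 := mul_eq_one_symm hHG
  refine ⟨LinearEquiv.ofLinear G H hGH hHG, ?_, ?_⟩
  · intro x y
    rw [LinearEquiv.ofLinear_apply, LinearEquiv.ofLinear_apply, hG, hG]
    simp only [add_l, add_r, smul_l, smul_r, a1, a2, a3, a4, a5, a6, a7, b1, b2, b3, b4, b6,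
      i1, i2, i2', i3]
    simp only [bUU]
    ring
  · intro x
    rw [LinearEquiv.ofLinear_apply]
    constructor
    · intro h
      have c1 := hiso _ h e he
      have c2 := hiso _ h e' he'
      rw [hG] at c1 c2
      simp only [add_l, smul_l, b1, b2, b3, b4, i1, i2, i2', i3] at c1 c2
      constructor <;> linarith
    · rintro ⟨c1, c2⟩
      rw [hG, c1, c2]
      simp only [zero_smul, add_zero]
      have hmem := J.smul_mem (x 2) he'
      exact J.add_mem (J.smul_mem _ he) hmem

/-- `O(U ⊕ U)` acts transitively on rank-2 saturated isotropic submodules of `U ⊕ U`. -/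
theorem stmt5 (J₁ J₂ : Submodule ℤ (Fin 4 → ℤ))
    (hrk₁ : Module.finrank ℤ J₁ = 2) (hrk₂ : Module.finrank ℤ J₂ = 2)
    (hiso₁ : ∀ x ∈ J₁, ∀ y ∈ J₁, bUU x y = 0)
    (hiso₂ : ∀ x ∈ J₂, ∀ y ∈ J₂, bUU x y = 0)
    (hsat₁ : ∀ (x : Fin 4 → ℤ) (c : ℤ), c ≠ 0 → c • x ∈ J₁ → x ∈ J₁)
    (hsat₂ : ∀ (x : Fin 4 → ℤ) (c : ℤ), c ≠ 0 → c • x ∈ J₂ → x ∈ J₂) :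
    ∃ g : (Fin 4 → ℤ) ≃ₗ[ℤ] (Fin 4 → ℤ),
      (∀ x y, bUU (g x) (g y) = bUU x y) ∧ J₁.map g.toLinearMap = J₂ := by
  obtain ⟨g₁, hg₁, hm₁⟩ := uu_hyp J₁ hrk₁ hiso₁ hsat₁
  obtain ⟨g₂, hg₂, hm₂⟩ := uu_hyp J₂ hrk₂ hiso₂ hsat₂
  refine ⟨g₁.symm.trans g₂, ?_, ?_⟩
  · intro x y
    rw [LinearEquiv.trans_apply, LinearEquiv.trans_apply, hg₂, ← hg₁]
    simp
  · ext y
    rw [Submodule.mem_map]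
    constructor
    · rintro ⟨x, hx, rfl⟩
      have h := (hm₁ (g₁.symm x)).1 (by simpa using hx)
      exact (hm₂ _).2 h
    · intro hy
      have h := (hm₂ (g₂.symm y)).1 (by simpa using hy)
      exact ⟨g₁ (g₂.symm y), (hm₁ _).2 h, by simp⟩
end

section
/- Let ℤ⁴ carry the symmetric bilinear form b with Gram matrix [[0,1],[1,0]] ⊕ [[0,2],[2,0]] (i.e., U ⊕ U(2)). Then the isometry group acts transitively on the set of rank-2 saturated isotropic submodules J ⊆ ℤ⁴ for which the map ℤ⁴ → Hom(J,ℤ), x ↦ b(x,·)|_J, is not surjective: any two such J are mapped to one another by a ℤ-linear automorphism of ℤ⁴ preserving b. -/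
/-- The form of `U ⊕ U(2)` on `ℤ⁴`. -/
def bUU2 (x y : Fin 4 → ℤ) : ℤ :=
  x 0 * y 1 + x 1 * y 0 + 2 * (x 2 * y 3) + 2 * (x 3 * y 2)

theorem aux_prim (y : Fin 4 → ℤ) (hy : y ≠ 0) :
    ∃ (d : ℤ) (z x : Fin 4 → ℤ), d ≠ 0 ∧ y = d • z ∧
      x 0 * z 0 + x 1 * z 1 + x 2 * z 2 + x 3 * z 3 = 1 := by
  obtain ⟨d, hd⟩ := (IsPrincipalIdealRing.principal (Ideal.span (Set.range y))).principal
  have h1 : ∀ i, ∃ c, y i = d * c := by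
    intro i
    have : y i ∈ Ideal.span (Set.range y) := Ideal.subset_span ⟨i, rfl⟩
    rw [hd] at this
    exact Ideal.mem_span_singleton.mp this
  choose z hz using h1
  have hd0 : d ≠ 0 := by
    rintro rfl
    apply hy
    funext i
    simp [hz i]
  have h2 : d ∈ Ideal.span (Set.range y) := by
    rw [hd]; exact Ideal.mem_span_singleton_self d
  obtain ⟨x, hx⟩ := Ideal.mem_span_range_iff_exists_fun.mp h2
  refine ⟨d, z, x, hd0, funext fun i => by simp [hz i], ?_⟩
  rw [Fin.sum_univ_four] at hx
  apply mul_left_cancel₀ hd0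
  simp only [hz] at hx
  linear_combination hx

/-- Rank two lets us find a primitive vector of `J` killed by a given functional. -/
theorem aux_exists (J : Submodule ℤ (Fin 4 → ℤ)) (hrk : Module.finrank ℤ J = 2)
    (hsat : ∀ (x : Fin 4 → ℤ) (c : ℤ), c ≠ 0 → c • x ∈ J → x ∈ J)
    (w : Fin 4 → ℤ) :
    ∃ z ∈ J, bUU2 z w = 0 ∧ ∃ x : Fin 4 → ℤ,
      x 0 * z 0 + x 1 * z 1 + x 2 * z 2 + x 3 * z 3 = 1 := by
  have key : ∃ y ∈ J, bUU2 y w = 0 ∧ y ≠ 0 := by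
    let B := Module.finBasisOfFinrankEq ℤ J hrk
    have hli := LinearIndependent.pair_iff.mp
      (show LinearIndependent ℤ ![B 0, B 1] by
        convert B.linearIndependent using 1
        funext i; fin_cases i <;> rfl)
    by_cases h0 : bUU2 (B 0) w = 0
    · refine ⟨B 0, (B 0).2, h0, ?_⟩
      simpa using B.ne_zero 0
    · refine ⟨(bUU2 (B 1) w • B 0 + (-bUU2 (B 0) w) • B 1 : J), Subtype.property _, ?_, ?_⟩
      · simp only [bUU2, Submodule.coe_add, Submodule.coe_smul, Pi.add_apply, Pi.smul_apply,
          smul_eq_mul]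
        ring
      · intro h
        have := hli (bUU2 (B 1) w) (-bUU2 (B 0) w) (Subtype.ext h)
        exact h0 (neg_eq_zero.mp this.2)
  obtain ⟨y, hyJ, hyw, hy0⟩ := key
  obtain ⟨d, z, x, hd, rfl, hx⟩ := aux_prim y hy0
  refine ⟨z, hsat z d hd hyJ, ?_, x, hx⟩
  apply mul_left_cancel₀ hd
  simp only [bUU2, Pi.smul_apply, smul_eq_mul] at hyw ⊢
  linear_combination hyw

/-- A primitive vector with even first coordinates has an even partner. -/
theorem aux_partner (z x : Fin 4 → ℤ) (a b : ℤ) (h0 : z 0 = 2 * a) (h1 : z 1 = 2 * b)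
    (hx : x 0 * z 0 + x 1 * z 1 + x 2 * z 2 + x 3 * z 3 = 1) :
    bUU2 z ![2 * x 1, 2 * x 0, x 3, x 2] = 2 := by
  simp [bUU2]
  linear_combination 2 * hx

theorem aux_odd (J : Submodule ℤ (Fin 4 → ℤ)) (hrk : Module.finrank ℤ J = 2)
    (hiso : ∀ x ∈ J, ∀ y ∈ J, bUU2 x y = 0)
    (hsat : ∀ (x : Fin 4 → ℤ) (c : ℤ), c ≠ 0 → c • x ∈ J → x ∈ J) :
    ∃ v ∈ J, ¬ (2 ∣ v 0 ∧ 2 ∣ v 1) := by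
  by_contra! H
  obtain ⟨u, huJ, -, x, hx⟩ := aux_exists J hrk hsat 0
  obtain ⟨⟨a, ha⟩, ⟨b, hb⟩⟩ := H u huJ
  have hp := aux_partner u x a b ha hb hx
  obtain ⟨u', huJ', hw, x', hx'⟩ := aux_exists J hrk hsat ![2 * x 1, 2 * x 0, x 3, x 2]
  obtain ⟨⟨a', ha'⟩, ⟨b', hb'⟩⟩ := H u' huJ'
  have h12 := hiso u huJ u' huJ'
  have h11 := hiso u huJ u huJ
  have h22 := hiso u' huJ' u' huJ'
  simp only [bUU2] at h12 h11 h22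
  simp [bUU2] at hw
  rw [ha, hb] at h11 hx
  rw [ha', hb'] at h22 hw hx'
  rw [ha, hb, ha', hb'] at h12
  generalize u 2 = c at *
  generalize u 3 = d at *
  generalize u' 2 = c' at *
  generalize u' 3 = d' at *
  have e1 : (c : ZMod 2) * d = 0 := by
    have : c * d = 2 * (-a * b) := by linarith
    have := congrArg (Int.cast : ℤ → ZMod 2) this
    push_cast at this
    rw [this, show (2 : ZMod 2) = 0 from rfl]; ring
  have e2 : (c' : ZMod 2) * d' = 0 := by
    have : c' * d' = 2 * (-a' * b') := by linarith
    have := congrArg (Int.cast : ℤ → ZMod 2) this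
    push_cast at this
    rw [this, show (2 : ZMod 2) = 0 from rfl]; ring
  have e3 : (c : ZMod 2) * d' + d * c' = 0 := by
    have : c * d' + d * c' = 2 * (-a * b' - b * a') := by linarith
    have := congrArg (Int.cast : ℤ → ZMod 2) this
    push_cast at this
    rw [this, show (2 : ZMod 2) = 0 from rfl]; ring
  have e4 : (x 2 : ZMod 2) * c + x 3 * d = 1 := by
    have := congrArg (Int.cast : ℤ → ZMod 2) hx
    push_cast at this
    rw [show (2 : ZMod 2) = 0 from rfl] at this
    linear_combination this
  have e5 : (x' 2 : ZMod 2) * c' + x' 3 * d' = 1 := by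
    have := congrArg (Int.cast : ℤ → ZMod 2) hx'
    push_cast at this
    rw [show (2 : ZMod 2) = 0 from rfl] at this
    linear_combination this
  have e6 : (x 2 : ZMod 2) * c' + x 3 * d' = 0 := by
    have : x 2 * c' + x 3 * d' = 2 * (-a' * x 0 - b' * x 1) := by linarith
    have := congrArg (Int.cast : ℤ → ZMod 2) this
    push_cast at this
    rw [this, show (2 : ZMod 2) = 0 from rfl]; ring
  have e7 : ¬ ((c' : ZMod 2) = 0 ∧ (d' : ZMod 2) = 0) := by
    rintro ⟨h, h'⟩
    rw [h, h'] at e5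
    simp at e5
  clear * - e1 e2 e3 e4 e6 e7
  generalize (c : ZMod 2) = c at *
  generalize (d : ZMod 2) = d at *
  generalize (c' : ZMod 2) = c' at *
  generalize (d' : ZMod 2) = d' at *
  generalize (x 2 : ZMod 2) = p at *
  generalize (x 3 : ZMod 2) = q at *
  have key : ∀ c d c' d' p q : ZMod 2, c * d = 0 ∧ c' * d' = 0 ∧ c * d' + d * c' = 0 ∧
      p * c + q * d = 1 ∧ p * c' + q * d' = 0 → c' = 0 ∧ d' = 0 := by decide
  exact e7 (key c d c' d' p q ⟨e1, e2, e3, e4, e6⟩)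

theorem aux_comm (x y : Fin 4 → ℤ) : bUU2 x y = bUU2 y x := by
  simp only [bUU2]; ring

theorem aux_add (x y z : Fin 4 → ℤ) : bUU2 (x + y) z = bUU2 x z + bUU2 y z := by
  simp only [bUU2, Pi.add_apply]; ring

theorem aux_smul (c : ℤ) (x z : Fin 4 → ℤ) : bUU2 (c • x) z = c * bUU2 x z := by
  simp only [bUU2, Pi.smul_apply, smul_eq_mul]; ring

theorem aux_add_right (x y z : Fin 4 → ℤ) : bUU2 z (x + y) = bUU2 z x + bUU2 z y := by
  simp only [bUU2, Pi.add_apply]; ring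

theorem aux_smul_right (c : ℤ) (x z : Fin 4 → ℤ) : bUU2 z (c • x) = c * bUU2 z x := by
  simp only [bUU2, Pi.smul_apply, smul_eq_mul]; ring

/-- First hyperbolic pair. -/
theorem aux_first (J : Submodule ℤ (Fin 4 → ℤ)) (hrk : Module.finrank ℤ J = 2)
    (hiso : ∀ x ∈ J, ∀ y ∈ J, bUU2 x y = 0)
    (hsat : ∀ (x : Fin 4 → ℤ) (c : ℤ), c ≠ 0 → c • x ∈ J → x ∈ J) :
    ∃ v ∈ J, ∃ w, bUU2 v w = 1 ∧ bUU2 w w = 0 := by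
  obtain ⟨y, hyJ, hy⟩ := aux_odd J hrk hiso hsat
  have hy0 : y ≠ 0 := by rintro rfl; simp at hy
  obtain ⟨d, v, x, hd, rfl, hx⟩ := aux_prim y hy0
  have hvJ := hsat v d hd hyJ
  have hv : ¬ (2 ∣ v 0 ∧ 2 ∣ v 1) := fun h => hy ⟨h.1.mul_left d, h.2.mul_left d⟩
  have hvv := hiso v hvJ v hvJ
  -- a partner with pairing one
  have hpart : ∃ w, bUU2 v w = 1 := by
    have h2 : ∃ w, bUU2 v w = 2 * (v 0 * x 0 + v 1 * x 1) + 2 * (v 2 * x 2 + v 3 * x 3) :=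
      ⟨![2 * x 1, 2 * x 0, x 3, x 2], by simp [bUU2]; ring⟩
    obtain ⟨w2, hw2⟩ := h2
    have hw2' : bUU2 v w2 = 2 := by rw [hw2]; linear_combination 2 * hx
    have h3 : ∃ w k, bUU2 v w = 2 * k + 1 := by
      by_cases h : 2 ∣ v 0
      · have : ¬ 2 ∣ v 1 := fun h' => hv ⟨h, h'⟩
        exact ⟨![1, 0, 0, 0], v 1 / 2, by simp [bUU2]; omega⟩
      · exact ⟨![0, 1, 0, 0], v 0 / 2, by simp [bUU2]; omega⟩
    obtain ⟨w1, k, hw1⟩ := h3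
    refine ⟨w1 + (-k) • w2, ?_⟩
    rw [aux_add_right, aux_smul_right, hw1, hw2']; ring
  obtain ⟨w, hw⟩ := hpart
  refine ⟨v, hvJ, w + (-(w 0 * w 1 + 2 * (w 2 * w 3))) • v, ?_, ?_⟩
  · rw [aux_add_right, aux_smul_right, hvv, hw]; ring
  · rw [aux_add_right, aux_smul_right, aux_add, aux_add, aux_smul, aux_smul, hvv, hw,
      aux_comm w v, hw]
    simp only [bUU2]; ring

theorem aux_basis (J : Submodule ℤ (Fin 4 → ℤ)) (hrk : Module.finrank ℤ J = 2)
    (hiso : ∀ x ∈ J, ∀ y ∈ J, bUU2 x y = 0)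
    (hsat : ∀ (x : Fin 4 → ℤ) (c : ℤ), c ≠ 0 → c • x ∈ J → x ∈ J) :
    ∃ v ∈ J, ∃ w, ∃ p ∈ J, ∃ q, bUU2 v w = 1 ∧ bUU2 w w = 0 ∧ bUU2 p w = 0 ∧
      bUU2 p q = 2 ∧ bUU2 q q = 0 ∧ bUU2 q v = 0 ∧ bUU2 q w = 0 ∧
      2 ∣ p 0 ∧ 2 ∣ p 1 ∧ 2 ∣ q 0 ∧ 2 ∣ q 1 := by
  obtain ⟨v, hvJ, w, hvw, hww⟩ := aux_first J hrk hiso hsat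
  obtain ⟨p, hpJ, hpw, x, hx⟩ := aux_exists J hrk hsat w
  have hvp := hiso v hvJ p hpJ
  have hpp := hiso p hpJ p hpJ
  have hvv := hiso v hvJ v hvJ
  have hpeven : 2 ∣ p 0 ∧ 2 ∣ p 1 := by
    have e1 : (v 0 : ZMod 2) * w 1 + v 1 * w 0 = 1 := by
      have := congrArg (Int.cast : ℤ → ZMod 2) hvw
      simp only [bUU2] at this
      push_cast at this
      rw [show (2 : ZMod 2) = 0 from rfl] at this
      linear_combination this
    have e2 : (p 0 : ZMod 2) * w 1 + p 1 * w 0 = 0 := by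
      have := congrArg (Int.cast : ℤ → ZMod 2) hpw
      simp only [bUU2] at this
      push_cast at this
      rw [show (2 : ZMod 2) = 0 from rfl] at this
      linear_combination this
    have e3 : (v 0 : ZMod 2) * p 1 + v 1 * p 0 = 0 := by
      have := congrArg (Int.cast : ℤ → ZMod 2) hvp
      simp only [bUU2] at this
      push_cast at this
      rw [show (2 : ZMod 2) = 0 from rfl] at this
      linear_combination this
    have h0 := ZMod.intCast_zmod_eq_zero_iff_dvd (p 0) 2
    have h1 := ZMod.intCast_zmod_eq_zero_iff_dvd (p 1) 2
    push_cast at h0 h1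
    rw [← h0, ← h1]
    clear * - e1 e2 e3
    generalize (v 0 : ZMod 2) = a at *
    generalize (v 1 : ZMod 2) = b at *
    generalize (w 0 : ZMod 2) = c at *
    generalize (w 1 : ZMod 2) = d at *
    generalize (p 0 : ZMod 2) = e at *
    generalize (p 1 : ZMod 2) = f at *
    revert a b c d e f
    decide
  obtain ⟨⟨a, ha⟩, ⟨b, hb⟩⟩ := hpeven
  have hpq0 := aux_partner p x a b ha hb hx
  obtain ⟨r, hr⟩ : ∃ r : Fin 4 → ℤ, r = ![2 * x 1, 2 * x 0, x 3, x 2] := ⟨_, rfl⟩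
  rw [← hr] at hpq0
  have hr0 : r 0 = 2 * x 1 := by simp [hr]
  have hr1 : r 1 = 2 * x 0 := by simp [hr]
  obtain ⟨m, hm⟩ : ∃ m, bUU2 r w = 2 * m :=
    ⟨x 1 * w 1 + x 0 * w 0 + r 2 * w 3 + r 3 * w 2, by simp only [bUU2, hr0, hr1]; ring⟩
  obtain ⟨n, hn⟩ : ∃ n, bUU2 r v = 2 * n :=
    ⟨x 1 * v 1 + x 0 * v 0 + r 2 * v 3 + r 3 * v 2, by simp only [bUU2, hr0, hr1]; ring⟩
  obtain ⟨s, hs⟩ : ∃ s, s = r + ((-2 * m) • v + (-2 * n) • w) := ⟨_, rfl⟩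
  have hsv : bUU2 s v = 0 := by
    rw [hs]; simp only [aux_add, aux_smul, hn, hvv, aux_comm w v, hvw]; ring
  have hsw : bUU2 s w = 0 := by
    rw [hs]; simp only [aux_add, aux_smul, hm, hww, hvw]; ring
  have hps : bUU2 p s = 2 := by
    rw [hs]; simp only [aux_add_right, aux_smul_right, hpq0, hpw, aux_comm p v, hvp]; ring
  obtain ⟨s0, hs0⟩ : 2 ∣ s 0 :=
    ⟨x 1 - m * v 0 - n * w 0, by rw [hs]; simp [hr0]; ring⟩
  obtain ⟨s1, hs1⟩ : 2 ∣ s 1 :=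
    ⟨x 0 - m * v 1 - n * w 1, by rw [hs]; simp [hr1]; ring⟩
  have hss : bUU2 s s = 4 * (2 * s0 * s1 + s 2 * s 3) := by
    simp only [bUU2, hs0, hs1]; ring
  generalize 2 * s0 * s1 + s 2 * s 3 = k at hss
  refine ⟨v, hvJ, w, p, hpJ, s + (-k) • p, hvw, hww, hpw, ?_, ?_, ?_, ?_, ⟨a, ha⟩, ⟨b, hb⟩,
    ⟨s0 - k * a, ?_⟩, ⟨s1 - k * b, ?_⟩⟩
  · simp only [aux_add_right, aux_smul_right, hps, hpp]; ring
  · simp only [aux_add, aux_smul, aux_add_right, aux_smul_right, hps, hpp, hss, aux_comm s p]; ring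
  · simp only [aux_add, aux_smul, hsv, aux_comm p v, hvp]; ring
  · simp only [aux_add, aux_smul, hsw, hpw]; ring
  · simp [hs0, ha]; ring
  · simp [hs1, hb]; ring

theorem aux_main (J : Submodule ℤ (Fin 4 → ℤ)) (hrk : Module.finrank ℤ J = 2)
    (hiso : ∀ x ∈ J, ∀ y ∈ J, bUU2 x y = 0)
    (hsat : ∀ (x : Fin 4 → ℤ) (c : ℤ), c ≠ 0 → c • x ∈ J → x ∈ J) :
    ∃ h : (Fin 4 → ℤ) ≃ₗ[ℤ] (Fin 4 → ℤ), (∀ x y, bUU2 (h x) (h y) = bUU2 x y) ∧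
      ∀ y, y ∈ J ↔ h y 1 = 0 ∧ h y 3 = 0 := by
  obtain ⟨v, hvJ, w, p, hpJ, q, hvw, hww, hpw, hpq, hqq, hqv, hqw, ⟨a, ha⟩, ⟨b, hb⟩,
    ⟨c, hc⟩, ⟨d, hd⟩⟩ := aux_basis J hrk hiso hsat
  have hvp := hiso v hvJ p hpJ
  have hpp := hiso p hpJ p hpJ
  have hvv := hiso v hvJ v hvJ
  let f : (Fin 4 → ℤ) →ₗ[ℤ] (Fin 4 → ℤ) :=
    { toFun := fun y => ![bUU2 y w, bUU2 y v,
        y 0 * d + y 1 * c + y 2 * q 3 + y 3 * q 2, y 0 * b + y 1 * a + y 2 * p 3 + y 3 * p 2]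
      map_add' := by
        intro x y; funext i; fin_cases i <;> simp [aux_add] <;> ring
      map_smul' := by
        intro x y; funext i; fin_cases i <;> simp [bUU2] <;> ring }
  have f0 : ∀ y, f y 0 = bUU2 y w := fun y => rfl
  have f1 : ∀ y, f y 1 = bUU2 y v := fun y => rfl
  have f2 : ∀ y, 2 * f y 2 = bUU2 y q := fun y => by
    change 2 * (y 0 * d + y 1 * c + y 2 * q 3 + y 3 * q 2) = _
    simp only [bUU2, hc, hd]; ring
  have f3 : ∀ y, 2 * f y 3 = bUU2 y p := fun y => by
    change 2 * (y 0 * b + y 1 * a + y 2 * p 3 + y 3 * p 2) = _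
    simp only [bUU2, ha, hb]; ring
  let g : (Fin 4 → ℤ) → (Fin 4 → ℤ) := fun x => x 0 • v + (x 1 • w + (x 2 • p + x 3 • q))
  have hwv := (aux_comm w v).trans hvw
  have hpv := (aux_comm p v).trans hvp
  have hwp := (aux_comm w p).trans hpw
  have hqp := (aux_comm q p).trans hpq
  have hvq := (aux_comm v q).trans hqv
  have hwq := (aux_comm w q).trans hqw
  have hfg : ∀ x, f (g x) = x := by
    intro x
    have t0 : f (g x) 0 = x 0 := by
      rw [f0]; simp only [g, aux_add, aux_smul, hvw, hww, hpw, hqw]; ring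
    have t1 : f (g x) 1 = x 1 := by
      rw [f1]; simp only [g, aux_add, aux_smul, hvv, hwv, hpv, hqv]; ring
    have t2 : f (g x) 2 = x 2 := by
      have := f2 (g x)
      simp only [g, aux_add, aux_smul, hvq, hwq, hpq, hqq] at this ⊢
      linarith
    have t3 : f (g x) 3 = x 3 := by
      have := f3 (g x)
      simp only [g, aux_add, aux_smul, hvp, hwp, hpp, hqp] at this ⊢
      linarith
    funext i; fin_cases i
    exacts [t0, t1, t2, t3]
  have hsurj : Function.Surjective f := fun x => ⟨g x, hfg x⟩
  have hinj : Function.Injective f := OrzechProperty.injective_of_surjective_endomorphism f hsurj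
  have hgf : ∀ y, g (f y) = y := fun y => hinj (hfg (f y))
  have hg : ∀ x y, bUU2 (g x) (g y) = bUU2 x y := by
    intro x y
    simp only [g, aux_add, aux_smul, aux_add_right, aux_smul_right, hvq, hwq, hpq, hqq, hvp, hwp,
      hpp, hqp, hvv, hwv, hpv, hqv, hvw, hww, hpw, hqw]
    simp only [bUU2]; ring
  have hbij : Function.Bijective f := ⟨hinj, hsurj⟩
  refine ⟨LinearEquiv.ofBijective f hbij, ?_, ?_⟩
  · intro x y
    change bUU2 (f x) (f y) = _
    rw [← hg, hgf, hgf]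
  · intro y
    change y ∈ J ↔ f y 1 = 0 ∧ f y 3 = 0
    constructor
    · intro hy
      refine ⟨by rw [f1]; exact hiso y hy v hvJ, ?_⟩
      have := f3 y
      rw [hiso y hy p hpJ] at this
      linarith
    · rintro ⟨h1, h3⟩
      rw [← hgf y]
      simp only [g, h1, h3, zero_smul, add_zero, zero_add]
      exact J.add_mem (J.smul_mem _ hvJ) (J.smul_mem _ hpJ)

/-- The isometry group of `U ⊕ U(2)` acts transitively on rank-2 saturated isotropic
submodules `J` for which the pairing map `ℤ⁴ → Hom(J,ℤ)` is not surjective. -/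
theorem stmt6 (J₁ J₂ : Submodule ℤ (Fin 4 → ℤ))
    (hrk₁ : Module.finrank ℤ J₁ = 2) (hrk₂ : Module.finrank ℤ J₂ = 2)
    (hiso₁ : ∀ x ∈ J₁, ∀ y ∈ J₁, bUU2 x y = 0)
    (hiso₂ : ∀ x ∈ J₂, ∀ y ∈ J₂, bUU2 x y = 0)
    (hsat₁ : ∀ (x : Fin 4 → ℤ) (c : ℤ), c ≠ 0 → c • x ∈ J₁ → x ∈ J₁)
    (hsat₂ : ∀ (x : Fin 4 → ℤ) (c : ℤ), c ≠ 0 → c • x ∈ J₂ → x ∈ J₂)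
    (hns₁ : ¬ ∀ φ : J₁ →ₗ[ℤ] ℤ, ∃ x : Fin 4 → ℤ, ∀ v : J₁, φ v = bUU2 x v)
    (hns₂ : ¬ ∀ φ : J₂ →ₗ[ℤ] ℤ, ∃ x : Fin 4 → ℤ, ∀ v : J₂, φ v = bUU2 x v) :
    ∃ g : (Fin 4 → ℤ) ≃ₗ[ℤ] (Fin 4 → ℤ),
      (∀ x y, bUU2 (g x) (g y) = bUU2 x y) ∧ J₁.map g.toLinearMap = J₂ := by
  obtain ⟨h₁, hb₁, hJ₁⟩ := aux_main J₁ hrk₁ hiso₁ hsat₁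
  obtain ⟨h₂, hb₂, hJ₂⟩ := aux_main J₂ hrk₂ hiso₂ hsat₂
  refine ⟨h₁.trans h₂.symm, ?_, ?_⟩
  · intro x y
    rw [← hb₂, ← hb₁ x y]
    simp
  · ext y
    rw [Submodule.mem_map]
    constructor
    · rintro ⟨x, hx, rfl⟩
      rw [hJ₂]
      simpa using (hJ₁ x).mp hx
    · intro hy
      refine ⟨h₁.symm (h₂ y), ?_, by simp⟩
      rw [hJ₁]
      simpa using (hJ₂ y).mp hy
end

section
/- Let f₂ ∈ ℂ[x₀,x₁,x₂,x₃] be a nonzero homogeneous polynomial of degree 2 and f₄ a homogeneous polynomial of degree 4 with f₄ ∉ (f₂). Suppose f₂ and f₄ have a nonconstant common factor. Then there exists a linear change of coordinates g ∈ GL₄(ℂ) and a nonzero scalar c such that, after applying g, exactly one of the following holds: (a) f₂ = c·x₀x₁ and f₄ = x₀·h with h homogeneous of degree 3 and x₁ ∤ h; or (b) f₂ = c·x₀² and f₄ = x₀·h with h homogeneous of degree 3 and x₀ ∤ h. -/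
open MvPolynomial

/-- The linear change of coordinates `g` acting on polynomials by substituting the
linear forms determined by `g` for the variables. -/
noncomputable def linSubst (g : Matrix (Fin 4) (Fin 4) ℂ)
    (f : MvPolynomial (Fin 4) ℂ) : MvPolynomial (Fin 4) ℂ :=
  MvPolynomial.aeval (fun i => ∑ j, MvPolynomial.C (g i j) * MvPolynomial.X j) f

theorem homog_of_mul {p q : MvPolynomial (Fin 4) ℂ} {n : ℕ} (h : (p * q).IsHomogeneous n)
    (h0 : p * q ≠ 0) : p.IsHomogeneous p.totalDegree ∧ q.IsHomogeneous q.totalDegree ∧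
      p.totalDegree + q.totalDegree = n := by
  have hp : p ≠ 0 := left_ne_zero_of_mul h0
  have hq : q ≠ 0 := right_ne_zero_of_mul h0
  have ht : p.totalDegree + q.totalDegree = n := by
    rw [← totalDegree_mul_of_isDomain hp hq, h.totalDegree h0]
  have hle : ∀ r : MvPolynomial (Fin 4) ℂ, r ≠ 0 →
      (r : MvPowerSeries (Fin 4) ℂ).order ≤ (r.totalDegree : ℕ∞) := by
    intro r hr
    obtain ⟨d, hd⟩ := MvPolynomial.support_nonempty.mpr hr
    have h1 : (r : MvPowerSeries (Fin 4) ℂ).order ≤ (d.degree : ℕ∞) := by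
      apply MvPowerSeries.order_le
      rw [MvPolynomial.coeff_coe]
      exact mem_support_iff.mp hd
    exact h1.trans (by exact_mod_cast le_totalDegree hd)
  have hge : (n : ℕ∞) ≤ (p : MvPowerSeries (Fin 4) ℂ).order +
      (q : MvPowerSeries (Fin 4) ℂ).order := by
    rw [← MvPowerSeries.order_mul, ← MvPolynomial.coe_mul]
    apply MvPowerSeries.nat_le_order
    intro d hd
    rw [MvPolynomial.coeff_coe]
    exact h.coeff_eq_zero (by omega)
  have key : ∀ r : MvPolynomial (Fin 4) ℂ,
      (r.totalDegree : ℕ∞) ≤ (r : MvPowerSeries (Fin 4) ℂ).order →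
      r.IsHomogeneous r.totalDegree := by
    intro r hr
    intro d hd
    have hw : (Finsupp.weight (1 : Fin 4 → ℕ)) d = d.degree :=
      (DFunLike.congr_fun Finsupp.degree_eq_weight_one d).symm
    rw [hw]
    have h1 : (r : MvPowerSeries (Fin 4) ℂ).order ≤ (d.degree : ℕ∞) := by
      apply MvPowerSeries.order_le
      rwa [MvPolynomial.coeff_coe]
    have h2 : r.totalDegree ≤ d.degree := by exact_mod_cast hr.trans h1
    have h3 : d.degree ≤ r.totalDegree := le_totalDegree (mem_support_iff.mpr hd)
    omega
  have ap := hle p hp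
  have aq := hle q hq
  obtain ⟨a, ha⟩ := ENat.ne_top_iff_exists.mp (ne_top_of_le_ne_top (ENat.natCast_ne_top _) ap)
  obtain ⟨b, hb⟩ := ENat.ne_top_iff_exists.mp (ne_top_of_le_ne_top (ENat.natCast_ne_top _) aq)
  rw [← ha] at ap
  rw [← hb] at aq
  rw [← ha, ← hb] at hge
  norm_cast at ap aq hge
  refine ⟨key p ?_, key q ?_, ht⟩
  · rw [← ha]; norm_cast; omega
  · rw [← hb]; norm_cast; omega

/-- The linear form with coefficient vector `a`. -/
noncomputable def linForm (a : Fin 4 → ℂ) : MvPolynomial (Fin 4) ℂ := ∑ i, C (a i) * X i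

theorem linForm_single (k : Fin 4) : linForm (Pi.single k 1) = X k := by
  classical
  simp only [linForm]
  rw [Finset.sum_eq_single k]
  · simp
  · intro b _ hb; simp [hb]
  · simp

theorem linForm_smul (t : ℂ) (a : Fin 4 → ℂ) : linForm (t • a) = C t * linForm a := by
  simp [linForm, Finset.mul_sum, mul_assoc]

theorem exists_linForm {p : MvPolynomial (Fin 4) ℂ} (h : p.IsHomogeneous 1) :
    ∃ a, p = linForm a := by
  refine ⟨fun i => coeff 0 (pderiv i p), ?_⟩
  have h1 := h.sum_X_mul_pderiv
  rw [one_smul] at h1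
  conv_lhs => rw [← h1]
  unfold linForm
  refine Finset.sum_congr rfl fun i _ => ?_
  have h2 : (pderiv i p).IsHomogeneous 0 := h.pderiv
  have h3 : (pderiv i p).totalDegree = 0 := Nat.le_zero.mp h2.totalDegree_le
  rw [totalDegree_eq_zero_iff_eq_C] at h3
  rw [← h3, mul_comm]

theorem linSubst_mul (g : Matrix (Fin 4) (Fin 4) ℂ) (p q : MvPolynomial (Fin 4) ℂ) :
    linSubst g (p * q) = linSubst g p * linSubst g q := by
  simp [linSubst]

theorem linSubst_linForm (g : Matrix (Fin 4) (Fin 4) ℂ) (a : Fin 4 → ℂ) :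
    linSubst g (linForm a) = linForm (Matrix.vecMul a g) := by
  simp only [linSubst, linForm, map_sum, map_mul, aeval_X, Matrix.vecMul, dotProduct,
    Finset.mul_sum, Finset.sum_mul, algHom_C, algebraMap_eq]
  rw [Finset.sum_comm]
  simp [mul_assoc]

theorem linSubst_homog (g : Matrix (Fin 4) (Fin 4) ℂ) {p : MvPolynomial (Fin 4) ℂ} {n : ℕ}
    (h : p.IsHomogeneous n) : (linSubst g p).IsHomogeneous n := by
  have := h.aeval (fun i => ∑ j, MvPolynomial.C (g i j) * MvPolynomial.X j) (n := 1)
    (fun i => IsHomogeneous.sum _ _ _ fun j _ => (isHomogeneous_X ℂ j).C_mul _)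
  simpa [linSubst] using this

theorem linSubst_comp (g g' : Matrix (Fin 4) (Fin 4) ℂ) (p : MvPolynomial (Fin 4) ℂ) :
    linSubst g' (linSubst g p) = linSubst (g * g') p := by
  induction p using MvPolynomial.induction_on with
  | C a => simp [linSubst]
  | add p q hp hq => simp only [linSubst, map_add] at *; rw [hp, hq]
  | mul_X p i hp =>
    rw [linSubst_mul, linSubst_mul, linSubst_mul, hp, ← linForm_single, linSubst_linForm,
      linSubst_linForm, linSubst_linForm, Matrix.vecMul_vecMul]

theorem linSubst_one (p : MvPolynomial (Fin 4) ℂ) : linSubst 1 p = p := by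
  have : (fun i : Fin 4 => ∑ j, C ((1 : Matrix (Fin 4) (Fin 4) ℂ) i j) * X j)
      = (X : Fin 4 → MvPolynomial (Fin 4) ℂ) := by
    funext i
    rw [Finset.sum_eq_single i]
    · simp
    · intro b _ hb; simp [Matrix.one_apply_ne hb.symm]
    · simp
  rw [linSubst, this, aeval_X_left_apply]

theorem linSubst_dvd {g : Matrix (Fin 4) (Fin 4) ℂ} (hg : IsUnit g)
    {p q : MvPolynomial (Fin 4) ℂ} (h : linSubst g p ∣ linSubst g q) : p ∣ q := by
  obtain ⟨u, rfl⟩ := hg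
  obtain ⟨r, hr⟩ := h
  refine ⟨linSubst (↑u⁻¹ : Matrix (Fin 4) (Fin 4) ℂ) r, ?_⟩
  have := congrArg (linSubst (↑u⁻¹ : Matrix (Fin 4) (Fin 4) ℂ)) hr
  rwa [linSubst_mul, linSubst_comp, linSubst_comp, Units.mul_inv, linSubst_one,
    linSubst_one] at this

theorem exists_matrix {ι : Type} [Finite ι] {v w : ι → (Fin 4 → ℂ)}
    (hv : LinearIndependent ℂ v) (hw : LinearIndependent ℂ w) :
    ∃ g : Matrix (Fin 4) (Fin 4) ℂ, IsUnit g ∧ ∀ i, Matrix.vecMul (v i) g = w i := by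
  have := FiniteDimensional.span_of_finite ℂ (Set.finite_range v)
  obtain ⟨L, hL⟩ := Submodule.exists_linearEquiv_restrict_eq
    ((Module.Basis.span hv).equiv (Module.Basis.span hw) (Equiv.refl ι))
  refine ⟨(LinearMap.toMatrix' (L : (Fin 4 → ℂ) →ₗ[ℂ] (Fin 4 → ℂ))).transpose, ?_, fun i => ?_⟩
  · rw [Matrix.isUnit_transpose]
    refine IsUnit.of_mul_eq_one
      (LinearMap.toMatrix' (L.symm : (Fin 4 → ℂ) →ₗ[ℂ] (Fin 4 → ℂ))) ?_
    rw [← LinearMap.toMatrix'_comp]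
    simp
  · rw [Matrix.vecMul_transpose, LinearMap.toMatrix'_mulVec]
    have h1 := hL (Module.Basis.span hv i)
    rw [Module.Basis.equiv_apply] at h1
    simp only [Module.Basis.span_apply, Equiv.refl_apply] at h1
    exact h1.symm

theorem X01_ne (c : ℂ) (hc : c ≠ 0) :
    c • (X 0 * X 1 : MvPolynomial (Fin 4) ℂ) ≠ c • (X 0 ^ 2) := by
  intro h
  have := congrArg (eval (fun i : Fin 4 => if i = 0 then (1 : ℂ) else 0)) h
  simp [smul_eval] at this
  exact hc this.symm

/-- Normal forms for pairs `(f₂,f₄)` with a nonconstant common factor (whose common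
zero locus fails to be a `(2,4)` complete intersection): after a linear change of
coordinates, exactly one of `f₂ = c·x₀x₁, f₄ = x₀h, x₁ ∤ h` or
`f₂ = c·x₀², f₄ = x₀h, x₀ ∤ h` holds. -/
theorem stmt8 (f₂ f₄ : MvPolynomial (Fin 4) ℂ)
    (h₂ : f₂.IsHomogeneous 2) (h₂0 : f₂ ≠ 0) (h₄ : f₄.IsHomogeneous 4)
    (h₄I : f₄ ∉ Ideal.span {f₂})
    (hcom : ∃ p : MvPolynomial (Fin 4) ℂ, ¬ IsUnit p ∧ p ∣ f₂ ∧ p ∣ f₄) :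
    ∃ (g : Matrix (Fin 4) (Fin 4) ℂ) (c : ℂ), IsUnit g ∧ c ≠ 0 ∧
      Xor'
        (∃ h : MvPolynomial (Fin 4) ℂ, h.IsHomogeneous 3 ∧
          linSubst g f₂ = c • (X 0 * X 1) ∧ linSubst g f₄ = X 0 * h ∧ ¬ X 1 ∣ h)
        (∃ h : MvPolynomial (Fin 4) ℂ, h.IsHomogeneous 3 ∧
          linSubst g f₂ = c • (X 0 ^ 2) ∧ linSubst g f₄ = X 0 * h ∧ ¬ X 0 ∣ h) := by
  obtain ⟨p, hpu, ⟨q, rfl⟩, ⟨r, rfl⟩⟩ := hcom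
  have h40 : p * r ≠ 0 := fun h => h₄I (by rw [h]; exact Ideal.zero_mem _)
  rw [Ideal.mem_span_singleton] at h₄I
  have hp0 : p ≠ 0 := left_ne_zero_of_mul h₂0
  have hq0 : q ≠ 0 := right_ne_zero_of_mul h₂0
  obtain ⟨hp, hq, hpq⟩ := homog_of_mul h₂ h₂0
  obtain ⟨-, hr, hpr⟩ := homog_of_mul h₄ h40
  have hunit : ∀ s : MvPolynomial (Fin 4) ℂ, s ≠ 0 → s.totalDegree = 0 → IsUnit s := by
    intro s hs h
    rw [totalDegree_eq_zero_iff_eq_C] at h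
    rw [h] at hs ⊢
    exact (IsUnit.mk0 _ (fun h0 => hs (by rw [h0, C_0]))).map C
  have hqr : ¬ q ∣ r := fun h => h₄I (mul_dvd_mul_left p h)
  have hp1 : p.totalDegree ≠ 0 := fun h => hpu (hunit p hp0 h)
  have hq1 : q.totalDegree ≠ 0 := fun h => hqr (hunit q hq0 h).dvd
  rw [show p.totalDegree = 1 by omega] at hp
  rw [show q.totalDegree = 1 by omega] at hq
  rw [show r.totalDegree = 3 by omega] at hr
  obtain ⟨a, rfl⟩ := exists_linForm hp
  obtain ⟨b, rfl⟩ := exists_linForm hq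
  have ha : a ≠ 0 := by rintro rfl; exact hp0 (by simp [linForm])
  have hb : b ≠ 0 := by rintro rfl; exact hq0 (by simp [linForm])
  by_cases hli : LinearIndependent ℂ ![a, b]
  · have hw : LinearIndependent ℂ
        (![Pi.single 0 1, Pi.single 1 1] : Fin 2 → (Fin 4 → ℂ)) := by
      rw [LinearIndependent.pair_iff]
      intro s t h
      exact ⟨by simpa using congrFun h 0, by simpa using congrFun h 1⟩
    obtain ⟨g, hg, hgi⟩ := exists_matrix hli hw
    have e0 : linSubst g (linForm a) = X 0 := by
      rw [linSubst_linForm, ← linForm_single]; congr 1; exact hgi 0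
    have e1 : linSubst g (linForm b) = X 1 := by
      rw [linSubst_linForm, ← linForm_single]; congr 1; exact hgi 1
    have e2 : linSubst g (linForm a * linForm b) = (1 : ℂ) • (X 0 * X 1) := by
      rw [linSubst_mul, e0, e1, one_smul]
    refine ⟨g, 1, hg, one_ne_zero, Or.inl ⟨⟨linSubst g r, linSubst_homog g hr, e2, ?_, ?_⟩, ?_⟩⟩
    · rw [linSubst_mul, e0]
    · intro h
      rw [← e1] at h
      exact hqr (linSubst_dvd hg h)
    · rintro ⟨h, -, h', -⟩
      exact X01_ne 1 one_ne_zero (e2.symm.trans h')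
  · rw [LinearIndependent.pair_iff' ha] at hli
    push Not at hli
    obtain ⟨c, rfl⟩ := hli
    have hc : c ≠ 0 := by rintro rfl; exact hb (zero_smul _ _)
    have hv : LinearIndependent ℂ (fun _ : Unit => a) := LinearIndependent.of_subsingleton () ha
    have hw : LinearIndependent ℂ (fun _ : Unit => (Pi.single 0 1 : Fin 4 → ℂ)) :=
      LinearIndependent.of_subsingleton () (by simp)
    obtain ⟨g, hg, hgi⟩ := exists_matrix hv hw
    have e0 : linSubst g (linForm a) = X 0 := by
      rw [linSubst_linForm, ← linForm_single]; congr 1; exact hgi ()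
    have e2 : linSubst g (linForm a * linForm (c • a)) = c • (X 0 ^ 2) := by
      rw [linForm_smul, linSubst_mul, linSubst_mul, e0, smul_eq_C_mul]
      simp only [linSubst, algHom_C, algebraMap_eq]
      ring
    refine ⟨g, c, hg, hc, Or.inr ⟨⟨linSubst g r, linSubst_homog g hr, e2, ?_, ?_⟩, ?_⟩⟩
    · rw [linSubst_mul, e0]
    · intro h
      rw [← e0] at h
      have hd := linSubst_dvd hg h
      apply hqr
      rw [linForm_smul]
      exact (((IsUnit.mk0 c hc).map C).mul_left_dvd).mpr hd
    · rintro ⟨h, -, h', -⟩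
      exact X01_ne c hc (h'.symm.trans e2)
end

section
/- Let k ≥ 2 and let M be the free ℤ-module with basis γ₀, γ₁, …, γ_k equipped with the symmetric bilinear form B determined by the D_{k+1} Dynkin diagram: B(γᵢ,γᵢ) = −2 for all i; B(γᵢ,γ_{i+1}) = 1 for 0 ≤ i ≤ k−3; B(γ_{k−2},γ_{k−1}) = B(γ_{k−2},γ_k) = 1; and B(γᵢ,γⱼ) = 0 for all other pairs i ≠ j. Define the k vectors v⁻ = γ_k − γ_{k−1}, v⁺ = γ_k + γ_{k−1}, and for each 1 ≤ i ≤ k−2, w_i = γ_k + γ_{k−1} + 2γ_{k−2} + 2γ_{k−3} + ⋯ + 2γᵢ. Then these k vectors are pairwise orthogonal with respect to B and each has B-square equal to −4. -/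
/-- Gram matrix of the `D_{k+1}` Dynkin diagram on the basis `γ₀, …, γ_k`:
`B(γᵢ,γᵢ) = −2`; `B(γᵢ,γ_{i+1}) = 1` for `0 ≤ i ≤ k−2` (chain `γ₀–…–γ_{k−1}`);
`B(γ_{k−2},γ_k) = 1`; all other off-diagonal pairings vanish. -/
def dynkinD (k : ℕ) (i j : Fin (k + 1)) : ℤ :=
  if i = j then -2
  else if (j.val = i.val + 1 ∧ i.val + 2 ≤ k) ∨ (i.val = j.val + 1 ∧ j.val + 2 ≤ k) ∨
      (i.val = k - 2 ∧ j.val = k) ∨ (j.val = k - 2 ∧ i.val = k) then 1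
  else 0

/-- The bilinear form on `ℤ^{k+1}` determined by the `D_{k+1}` Gram matrix. -/
def bDyn (k : ℕ) (x y : Fin (k + 1) → ℤ) : ℤ := ∑ i, ∑ j, x i * dynkinD k i j * y j

/-- The basis vector `γᵢ`. -/
def gammaD (k : ℕ) (i : Fin (k + 1)) : Fin (k + 1) → ℤ := Pi.single i 1

/-- `v⁻ = γ_k − γ_{k−1}`. -/
def vMinus (k : ℕ) : Fin (k + 1) → ℤ :=
  gammaD k ⟨k, Nat.lt_succ_self k⟩ - gammaD k ⟨k - 1, by omega⟩

/-- `v⁺ = γ_k + γ_{k−1}`. -/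
def vPlus (k : ℕ) : Fin (k + 1) → ℤ :=
  gammaD k ⟨k, Nat.lt_succ_self k⟩ + gammaD k ⟨k - 1, by omega⟩

/-- `w_i = γ_k + γ_{k−1} + 2γ_{k−2} + ⋯ + 2γ_i`. -/
def wVec (k i : ℕ) : Fin (k + 1) → ℤ :=
  vPlus k + ∑ j ∈ (Finset.Icc i (k - 2)).attach,
    (2 : ℤ) • gammaD k ⟨(j : ℕ), by
      have h := j.2
      rw [Finset.mem_Icc] at h
      omega⟩

/-- Basis vector with natural-number index. -/
def gN (k n : ℕ) : Fin (k + 1) → ℤ := fun x => if x.val = n then 1 else 0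

/-- Gram matrix with natural-number indices. -/
def dN (k a b : ℕ) : ℤ :=
  if a = b then -2
  else if (b = a + 1 ∧ a + 2 ≤ k) ∨ (a = b + 1 ∧ b + 2 ≤ k) ∨
      (a = k - 2 ∧ b = k) ∨ (b = k - 2 ∧ a = k) then 1
  else 0

theorem gammaD_eq (k n : ℕ) (h : n < k + 1) : gammaD k ⟨n, h⟩ = gN k n := by
  funext x
  simp [gammaD, gN, Pi.single_apply, Fin.ext_iff]

theorem bDyn_add_left (k : ℕ) (x x' y : Fin (k + 1) → ℤ) :
    bDyn k (x + x') y = bDyn k x y + bDyn k x' y := by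
  simp [bDyn, add_mul, Finset.sum_add_distrib]

theorem bDyn_add_right (k : ℕ) (x y y' : Fin (k + 1) → ℤ) :
    bDyn k x (y + y') = bDyn k x y + bDyn k x y' := by
  simp [bDyn, mul_add, Finset.sum_add_distrib]

theorem bDyn_smul_left (k : ℕ) (c : ℤ) (x y : Fin (k + 1) → ℤ) :
    bDyn k (c • x) y = c * bDyn k x y := by
  simp [bDyn, Finset.mul_sum, mul_assoc]

theorem bDyn_smul_right (k : ℕ) (c : ℤ) (x y : Fin (k + 1) → ℤ) :
    bDyn k x (c • y) = c * bDyn k x y := by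
  simp only [bDyn, Finset.mul_sum, Pi.smul_apply, smul_eq_mul]
  refine Finset.sum_congr rfl fun i _ => Finset.sum_congr rfl fun j _ => by ring

theorem bDyn_gN (k a b : ℕ) (ha : a ≤ k) (hb : b ≤ k) :
    bDyn k (gN k a) (gN k b) = dN k a b := by
  rw [← gammaD_eq k a (by omega), ← gammaD_eq k b (by omega)]
  simp only [bDyn, gammaD, Pi.single_apply, ite_mul, mul_ite, one_mul, mul_one, zero_mul, mul_zero,
    Finset.sum_ite_eq', Finset.mem_univ, if_true]
  simp [dynkinD, dN]

theorem vPlus_eq (k : ℕ) : vPlus k = gN k k + gN k (k - 1) := by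
  simp only [vPlus, gammaD_eq]

theorem vMinus_eq (k : ℕ) : vMinus k = gN k k + (-1 : ℤ) • gN k (k - 1) := by
  simp only [vMinus, gammaD_eq]
  rw [neg_one_smul, sub_eq_add_neg]

theorem wVec_eq (k i : ℕ) :
    wVec k i = vPlus k + ∑ j ∈ Finset.Icc i (k - 2), (2 : ℤ) • gN k j := by
  simp only [wVec, gammaD_eq]
  rw [Finset.sum_attach (Finset.Icc i (k - 2)) (fun j => (2 : ℤ) • gN k j)]

theorem wVec_top (k : ℕ) : wVec k (k - 2 + 1) = vPlus k := by
  simp [wVec_eq]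

theorem wVec_step (k i : ℕ) (h : i ≤ k - 2) :
    wVec k i = wVec k (i + 1) + (2 : ℤ) • gN k i := by
  rw [wVec_eq, wVec_eq, ← Finset.add_sum_Ioc_eq_sum_Icc h]
  have : Finset.Ioc i (k - 2) = Finset.Icc (i + 1) (k - 2) := by
    ext x; simp [Finset.mem_Ioc, Finset.mem_Icc]
  rw [this]; abel

theorem gN_vPlus (k m : ℕ) (hm : m ≤ k) :
    bDyn k (gN k m) (vPlus k) = dN k m k + dN k m (k - 1) := by
  rw [vPlus_eq, bDyn_add_right, bDyn_gN k m k hm le_rfl, bDyn_gN k m (k - 1) hm (by omega)]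

theorem gN_wVec (k : ℕ) (hk : 2 ≤ k) (m : ℕ) (hm : m ≤ k) (d i : ℕ) (h : i + d = k - 2) :
    bDyn k (gN k m) (wVec k i) = if m + 1 = i then 2 else if m = i then -2 else 0 := by
  induction d generalizing i with
  | zero =>
    rw [wVec_step k i (by omega)]
    obtain rfl : i = k - 2 := by omega
    rw [wVec_top, bDyn_add_right, bDyn_smul_right, gN_vPlus k m hm, bDyn_gN k m _ hm (by omega)]
    simp only [dN]
    split_ifs <;> (try simp only [true_and, and_true] at *) <;> omega
  | succ d ih =>
    rw [wVec_step k i (by omega), bDyn_add_right, bDyn_smul_right, ih (i + 1) (by omega),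
      bDyn_gN k m _ hm (by omega)]
    simp only [dN]
    split_ifs <;> omega

theorem vPlus_wVec (k : ℕ) (hk : 2 ≤ k) (i : ℕ) (h : i ≤ k - 2) :
    bDyn k (vPlus k) (wVec k i) = 0 := by
  rw [vPlus_eq, bDyn_add_left, gN_wVec k hk k le_rfl (k - 2 - i) i (by omega),
    gN_wVec k hk (k - 1) (by omega) (k - 2 - i) i (by omega)]
  split_ifs <;> omega

theorem vMinus_wVec (k : ℕ) (hk : 2 ≤ k) (i : ℕ) (h : i ≤ k - 2) :
    bDyn k (vMinus k) (wVec k i) = 0 := by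
  rw [vMinus_eq, bDyn_add_left, bDyn_smul_left,
    gN_wVec k hk k le_rfl (k - 2 - i) i (by omega),
    gN_wVec k hk (k - 1) (by omega) (k - 2 - i) i (by omega)]
  split_ifs <;> omega

theorem wVec_wVec (k : ℕ) (hk : 2 ≤ k) (i : ℕ) (hi : i ≤ k - 2) (d j : ℕ)
    (h : j + d = k - 2) (hj : 1 ≤ j) :
    bDyn k (wVec k j) (wVec k i) = if j = i then -4 else 0 := by
  have key : ∀ d j : ℕ, j + d = k - 2 + 1 →
      bDyn k (wVec k j) (wVec k i) = if j = i then -4 else 0 := by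
    intro d
    induction d with
    | zero =>
      intro j h
      obtain rfl : j = k - 2 + 1 := by omega
      rw [wVec_top, vPlus_wVec k hk i hi, if_neg (by omega)]
    | succ d ih =>
      intro j h
      rw [wVec_step k j (by omega), bDyn_add_left, bDyn_smul_left, ih (j + 1) (by omega),
        gN_wVec k hk j (by omega) (k - 2 - i) i (by omega)]
      split_ifs <;> omega
  exact key (d + 1) j (by omega)

/-- In the `D_{k+1}` lattice (`k ≥ 2`), the `k` vectors `v⁻ = γ_k − γ_{k−1}`,
`v⁺ = γ_k + γ_{k−1}` and `w_i = γ_k + γ_{k−1} + 2γ_{k−2} + ⋯ + 2γ_i`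
(`1 ≤ i ≤ k−2`) are pairwise orthogonal and each has square `−4`. -/
theorem stmt13 (k : ℕ) (hk : 2 ≤ k) :
    bDyn k (vMinus k) (vMinus k) = -4 ∧
      bDyn k (vPlus k) (vPlus k) = -4 ∧
      bDyn k (vMinus k) (vPlus k) = 0 ∧
      (∀ i : ℕ, 1 ≤ i → i ≤ k - 2 →
        bDyn k (wVec k i) (wVec k i) = -4 ∧
          bDyn k (vMinus k) (wVec k i) = 0 ∧ bDyn k (vPlus k) (wVec k i) = 0) ∧
      (∀ i i' : ℕ, 1 ≤ i → i ≤ k - 2 → 1 ≤ i' → i' ≤ k - 2 → i ≠ i' →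
        bDyn k (wVec k i) (wVec k i') = 0) := by
  refine ⟨?_, ?_, ?_, fun i h1 h2 => ⟨?_, vMinus_wVec k hk i h2, vPlus_wVec k hk i h2⟩,
    fun i i' h1 h2 h3 h4 hne => ?_⟩
  · simp only [vMinus_eq, bDyn_add_left, bDyn_add_right, bDyn_smul_left, bDyn_smul_right]
    rw [bDyn_gN k k k (by omega) (by omega), bDyn_gN k k (k - 1) (by omega) (by omega),
      bDyn_gN k (k - 1) k (by omega) (by omega), bDyn_gN k (k - 1) (k - 1) (by omega) (by omega)]
    simp only [dN]
    split_ifs <;> omega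
  · simp only [vPlus_eq, bDyn_add_left, bDyn_add_right]
    rw [bDyn_gN k k k (by omega) (by omega), bDyn_gN k k (k - 1) (by omega) (by omega),
      bDyn_gN k (k - 1) k (by omega) (by omega), bDyn_gN k (k - 1) (k - 1) (by omega) (by omega)]
    simp only [dN]
    split_ifs <;> omega
  · simp only [vMinus_eq, vPlus_eq, bDyn_add_left, bDyn_add_right, bDyn_smul_left]
    rw [bDyn_gN k k k (by omega) (by omega), bDyn_gN k k (k - 1) (by omega) (by omega),
      bDyn_gN k (k - 1) k (by omega) (by omega), bDyn_gN k (k - 1) (k - 1) (by omega) (by omega)]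
    simp only [dN]
    split_ifs <;> omega
  · rw [wVec_wVec k hk i h2 (k - 2 - i) i (by omega) h1, if_pos rfl]
  · rw [wVec_wVec k hk i' h4 (k - 2 - i) i (by omega) h1, if_neg hne]
end

section
/- For n ≥ 1 let Λ be the free ℤ-module ℤ² ⊕ ℤ² ⊕ D_n with the symmetric bilinear form b given as the orthogonal direct sum of two hyperbolic planes (Gram matrix [[0,1],[1,0]] on each ℤ² factor) and the form on D_n = {x ∈ ℤⁿ : ∑ᵢ xᵢ ≡ 0 (mod 2)} given by b(x,y) = −∑ᵢ xᵢyᵢ. Then: (i) every primitive isotropic vector v ∈ Λ has divisibility div(v) ∈ {1,2}; and (ii) there exists a primitive isotropic vector v ∈ Λ with div(v) = 2 if and only if n ≡ 0 (mod 8). -/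
/-- The bilinear form of `U ⊕ U ⊕ D_n` on the ambient module `ℤ⁴ × ℤⁿ`. -/
def bHyp (n : ℕ) (x y : (Fin 4 → ℤ) × (Fin n → ℤ)) : ℤ :=
  x.1 0 * y.1 1 + x.1 1 * y.1 0 + x.1 2 * y.1 3 + x.1 3 * y.1 2 - ∑ i, x.2 i * y.2 i

/-- The lattice `Λ = U² ⊕ D_n`, realized inside `ℤ⁴ × ℤⁿ` as the vectors whose
`D_n`-part has even coordinate sum. -/
noncomputable def LambdaD (n : ℕ) : Submodule ℤ ((Fin 4 → ℤ) × (Fin n → ℤ)) :=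
  Submodule.comap
    ((∑ i : Fin n, LinearMap.proj i) ∘ₗ LinearMap.snd ℤ (Fin 4 → ℤ) (Fin n → ℤ))
    (Ideal.span {(2 : ℤ)})

theorem mem_LD (n : ℕ) (v : (Fin 4 → ℤ) × (Fin n → ℤ)) :
    v ∈ LambdaD n ↔ (2 : ℤ) ∣ ∑ i, v.2 i := by
  simp [LambdaD, Ideal.mem_span_singleton]

def IsPrimD (n : ℕ) (v : (Fin 4 → ℤ) × (Fin n → ℤ)) : Prop :=
  ∀ x ∈ LambdaD n, ∀ c : ℤ, c ≠ 0 → c • x ∈ Submodule.span ℤ {v} →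
        x ∈ Submodule.span ℤ {v}

theorem prim_unit {n : ℕ} {v u : (Fin 4 → ℤ) × (Fin n → ℤ)} {m : ℤ} (hv : v ≠ 0)
    (hp : IsPrimD n v) (hu : u ∈ LambdaD n) (h : v = m • u) : m ∣ 1 := by
  have hm : m ≠ 0 := by
    rintro rfl
    exact hv (by simpa using h)
  have h1 := hp u hu m hm (by rw [← h]; exact Submodule.mem_span_singleton_self v)
  obtain ⟨k, hk⟩ := Submodule.mem_span_singleton.1 h1
  refine ⟨k, ?_⟩
  have h2 : (1 - m * k) • v = 0 := by
    rw [sub_smul, mul_smul, hk, ← h]; simp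
  rcases smul_eq_zero.1 h2 with h3 | h3
  · linarith
  · exact absurd h3 hv

theorem sq_sum_even {n : ℕ} (w : Fin n → ℤ) (h : (2 : ℤ) ∣ ∑ i, w i * w i) :
    (2 : ℤ) ∣ ∑ i, w i := by
  have : (2 : ℤ) ∣ ∑ i, w i * w i - ∑ i, w i := by
    rw [← Finset.sum_sub_distrib]
    apply Finset.dvd_sum
    intro i _
    have := Int.even_mul_pred_self (w i)
    rw [mul_sub, mul_one] at this
    exact even_iff_two_dvd.1 this
  exact (dvd_sub_right h).1 this

theorem not_all_even {n : ℕ} {v : (Fin 4 → ℤ) × (Fin n → ℤ)} (hv : v ≠ 0)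
    (hp : IsPrimD n v) (hb : bHyp n v v = 0) (h1 : ∀ i, (2 : ℤ) ∣ v.1 i)
    (h2 : ∀ i, (2 : ℤ) ∣ v.2 i) : False := by
  choose a ha using h1
  choose w hw using h2
  have hs : ∑ i, v.2 i * v.2 i = 4 * ∑ i, w i * w i := by
    rw [Finset.mul_sum]
    refine Finset.sum_congr rfl fun i _ => ?_
    rw [hw]; ring
  have hmem : ((a, w) : (Fin 4 → ℤ) × (Fin n → ℤ)) ∈ LambdaD n := by
    rw [mem_LD]
    apply sq_sum_even
    refine ⟨a 0 * a 1 + a 2 * a 3, ?_⟩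
    unfold bHyp at hb
    rw [hs] at hb
    simp only [ha] at hb
    linarith
  have := prim_unit (m := 2) hv hp hmem (by
    ext i
    · simp [ha]
    · simp [hw])
  omega

theorem b_single1 {n : ℕ} (v : (Fin 4 → ℤ) × (Fin n → ℤ)) (g : ℤ)
    (h : ∀ x ∈ LambdaD n, g ∣ bHyp n v x) (i : Fin 4) : g ∣ v.1 i := by
  have key : ∀ j, g ∣ bHyp n v (Pi.single j 1, 0) := fun j => h _ (by simp [mem_LD])
  have k0 := key 0
  have k1 := key 1
  have k2 := key 2
  have k3 := key 3
  simp [bHyp, Pi.single_apply] at k0 k1 k2 k3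
  fin_cases i <;> assumption

theorem b_w {n : ℕ} (v : (Fin 4 → ℤ) × (Fin n → ℤ)) (g : ℤ)
    (h : ∀ x ∈ LambdaD n, g ∣ bHyp n v x) (i j : Fin n) : g ∣ v.2 i + v.2 j := by
  have key := h (0, Pi.single i 1 + Pi.single j 1)
    (by simp [mem_LD, Finset.sum_add_distrib])
  simpa [bHyp, mul_add, Finset.sum_add_distrib, Pi.single_apply, ← dvd_neg (b := v.2 i + v.2 j), add_comm] using key

def valI (n : ℕ) (v : (Fin 4 → ℤ) × (Fin n → ℤ)) : Ideal ℤ where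
  carrier := {t | ∃ x ∈ LambdaD n, bHyp n v x = t}
  zero_mem' := ⟨0, Submodule.zero_mem _, by simp [bHyp]⟩
  add_mem' := by
    rintro _ _ ⟨x, hx, rfl⟩ ⟨y, hy, rfl⟩
    refine ⟨x + y, Submodule.add_mem _ hx hy, ?_⟩
    simp [bHyp, mul_add, Finset.sum_add_distrib]
    ring
  smul_mem' := by
    rintro c _ ⟨x, hx, rfl⟩
    refine ⟨c • x, Submodule.smul_mem _ c hx, ?_⟩
    simp only [bHyp, Prod.smul_fst, Prod.smul_snd, Pi.smul_apply, smul_eq_mul, mul_sub,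
      Finset.mul_sum, mul_left_comm]
    ring

theorem part1 {n : ℕ} {v : (Fin 4 → ℤ) × (Fin n → ℤ)} (hmem : v ∈ LambdaD n) (hv : v ≠ 0)
    (hp : IsPrimD n v) (hb : bHyp n v v = 0) :
    ((∃ x ∈ LambdaD n, bHyp n v x = 1) ∨
        ((∀ x ∈ LambdaD n, 2 ∣ bHyp n v x) ∧ ∃ x ∈ LambdaD n, bHyp n v x = 2)) := by
  obtain ⟨g, hg⟩ := (IsPrincipalIdealRing.principal (valI n v)).principal
  have hI : ∀ t, (∃ x ∈ LambdaD n, bHyp n v x = t) ↔ g ∣ t := by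
    intro t
    rw [← Ideal.mem_span_singleton]
    change t ∈ valI n v ↔ _
    rw [hg]
  have hd : ∀ x ∈ LambdaD n, g ∣ bHyp n v x := fun x hx => (hI _).1 ⟨x, hx, rfl⟩
  have h1 := b_single1 v g hd
  have h2 : ∀ i, g ∣ 2 * v.2 i := fun i => by
    rw [two_mul]; exact b_w v g hd i i
  have h4 : ¬ (4 : ℤ) ∣ g := by
    intro h4
    refine not_all_even hv hp hb (fun i => ?_) (fun i => ?_)
    · have := h4.trans (h1 i); omega
    · have := h4.trans (h2 i); omega
  have hodd : ∀ m : ℤ, Odd m → m ∣ g → m ∣ 1 := by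
    intro m hm hmg
    have hc : IsCoprime m 2 := by
      rw [Int.isCoprime_iff_gcd_eq_one]
      exact Int.isCoprime_iff_gcd_eq_one.1 (Int.isCoprime_two_right.2 hm)
    have h3 : ∀ i, m ∣ v.2 i := fun i => hc.dvd_of_dvd_mul_left (hmg.trans (h2 i))
    have h5 : ∀ i, m ∣ v.1 i := fun i => hmg.trans (h1 i)
    choose w hw using h3
    choose a ha using h5
    refine prim_unit (u := (a, w)) hv hp ?_ ?_
    · rw [mem_LD] at hmem ⊢
      simp only [hw, ← Finset.mul_sum] at hmem
      exact hc.symm.dvd_of_dvd_mul_left hmem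
    · ext i
      · simp [ha]
      · simp [hw]
  rw [hI, hI]
  rcases Int.even_or_odd g with he | ho
  · right
    obtain ⟨k, hk⟩ := he
    refine ⟨fun x hx => dvd_trans ⟨k, by omega⟩ (hd x hx), ?_⟩
    have hk1 := hodd k (by rw [← Int.not_even_iff_odd]; rintro ⟨l, hl⟩; exact h4 ⟨l, by omega⟩)
      ⟨2, by omega⟩
    have := mul_dvd_mul_left 2 hk1
    rw [hk, ← two_mul]
    simpa using this
  · left; exact hodd g ho dvd_rfl

theorem part2 {n : ℕ} (hn : 1 ≤ n) {v : (Fin 4 → ℤ) × (Fin n → ℤ)} (hv : v ≠ 0)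
    (hp : IsPrimD n v) (hb : bHyp n v v = 0) (hd : ∀ x ∈ LambdaD n, 2 ∣ bHyp n v x) :
    8 ∣ n := by
  have h1 := b_single1 v 2 hd
  have h2 := b_w v 2 hd
  by_cases he : (2 : ℤ) ∣ v.2 ⟨0, hn⟩
  · exact (not_all_even hv hp hb h1 fun i => (dvd_add_left he).1 (h2 i _)).elim
  have ho : ∀ i, (8 : ℤ) ∣ v.2 i * v.2 i - 1 := by
    intro i
    have h3 : Odd (v.2 i) := by
      rw [← Int.not_even_iff_odd, even_iff_two_dvd]
      intro h
      exact he ((dvd_add_right h).1 (h2 i _))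
    have := Int.eight_dvd_sq_sub_one_of_odd h3
    rwa [sq] at this
  have hs : (8 : ℤ) ∣ ∑ i, v.2 i * v.2 i - n := by
    have : ∑ i, v.2 i * v.2 i - (n : ℤ) = ∑ i, (v.2 i * v.2 i - 1) := by
      simp
    rw [this]
    exact Finset.dvd_sum fun i _ => ho i
  choose a ha using h1
  unfold bHyp at hb
  simp only [ha] at hb
  have h8 : (8 : ℤ) ∣ ∑ i, v.2 i * v.2 i := ⟨a 0 * a 1 + a 2 * a 3, by linarith⟩
  have := (dvd_sub_right h8).1 hs
  exact_mod_cast this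

theorem part3 {n : ℕ} (hn : 1 ≤ n) (h8 : 8 ∣ n) :
    ∃ v : (Fin 4 → ℤ) × (Fin n → ℤ), v ∈ LambdaD n ∧ v ≠ 0 ∧ IsPrimD n v ∧
          bHyp n v v = 0 ∧ (∀ x ∈ LambdaD n, 2 ∣ bHyp n v x) ∧
          ∃ x ∈ LambdaD n, bHyp n v x = 2 := by
  obtain ⟨m, hm⟩ := h8
  have hm' : (n : ℤ) = 8 * m := by exact_mod_cast hm
  refine ⟨(![2, 2 * m, 0, 0], fun _ => 1), ?_, ?_, ?_, ?_, ?_, (![0, 1, 0, 0], 0), ?_, ?_⟩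
  · rw [mem_LD]
    simp only [Finset.sum_const, Finset.card_univ, Fintype.card_fin, nsmul_eq_mul, mul_one]
    omega
  · intro h
    have := congrFun (congrArg Prod.fst h) 0
    simp at this
  · intro x _ c hc hx
    obtain ⟨k, hk⟩ := Submodule.mem_span_singleton.1 hx
    have h0 : k = c * x.2 ⟨0, hn⟩ := by
      have := congrFun (congrArg Prod.snd hk) ⟨0, hn⟩
      simpa using this
    rw [h0, mul_smul] at hk
    exact Submodule.mem_span_singleton.2 ⟨_, smul_right_injective _ hc hk⟩
  · simp [bHyp, hm']
    ring
  · intro x hx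
    rw [mem_LD] at hx
    simp only [bHyp, one_mul]
    refine dvd_sub ?_ hx
    refine ⟨x.1 1 + m * x.1 0, ?_⟩
    simp
    ring
  · simp [mem_LD]
  · simp [bHyp]

/-- In `Λ = U² ⊕ D_n`: (i) every primitive isotropic vector has divisibility `1` or `2`
(the subgroup `b(v,Λ) ⊆ ℤ` equals `ℤ` or `2ℤ`); (ii) a primitive isotropic vector of
divisibility `2` exists if and only if `n ≡ 0 (mod 8)`. -/
theorem stmt14 (n : ℕ) (hn : 1 ≤ n) :
    (∀ v : (Fin 4 → ℤ) × (Fin n → ℤ), v ∈ LambdaD n → v ≠ 0 →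
      (∀ x ∈ LambdaD n, ∀ c : ℤ, c ≠ 0 → c • x ∈ Submodule.span ℤ {v} →
        x ∈ Submodule.span ℤ {v}) →
      bHyp n v v = 0 →
      ((∃ x ∈ LambdaD n, bHyp n v x = 1) ∨
        ((∀ x ∈ LambdaD n, 2 ∣ bHyp n v x) ∧ ∃ x ∈ LambdaD n, bHyp n v x = 2))) ∧
      ((∃ v : (Fin 4 → ℤ) × (Fin n → ℤ), v ∈ LambdaD n ∧ v ≠ 0 ∧
          (∀ x ∈ LambdaD n, ∀ c : ℤ, c ≠ 0 → c • x ∈ Submodule.span ℤ {v} →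
            x ∈ Submodule.span ℤ {v}) ∧
          bHyp n v v = 0 ∧ (∀ x ∈ LambdaD n, 2 ∣ bHyp n v x) ∧
          ∃ x ∈ LambdaD n, bHyp n v x = 2) ↔ 8 ∣ n) := by
  refine ⟨fun v h1 h2 h3 h4 => part1 h1 h2 h3 h4, ?_, ?_⟩
  · rintro ⟨v, _, h2, h3, h4, h5, _⟩
    exact part2 hn h2 h3 h4 h5
  · exact fun h => part3 hn h
end

section
/- For n ≥ 1 let Λ = U ⊕ U ⊕ D_n with its standard symmetric bilinear form b. Let J ⊆ Λ be a rank-2 saturated isotropic submodule such that the ℤ-linear map Λ → Hom(J,ℤ), x ↦ b(x,·)|_J, is surjective. Then there exists a submodule H ⊆ Λ with J ⊆ H such that (H, b|_H) is isometric to U ⊕ U, Λ is the internal orthogonal direct sum of H and its orthogonal complement H^⊥ (i.e., Λ = H ⊕ H^⊥ with b(H,H^⊥)=0), and H^⊥ is an even negative definite lattice of rank n (b(x,x) ∈ 2ℤ for all x ∈ H^⊥, and b(x,x) < 0 for all nonzero x ∈ H^⊥). -/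
theorem bHyp_comm (n : ℕ) (x y : (Fin 4 → ℤ) × (Fin n → ℤ)) : bHyp n x y = bHyp n y x := by
  unfold bHyp
  have : ∑ i, x.2 i * y.2 i = ∑ i, y.2 i * x.2 i :=
    Finset.sum_congr rfl fun i _ => mul_comm _ _
  rw [this]; ring

theorem bHyp_add_left (n : ℕ) (x y z : (Fin 4 → ℤ) × (Fin n → ℤ)) :
    bHyp n (x + y) z = bHyp n x z + bHyp n y z := by
  unfold bHyp
  simp only [Prod.fst_add, Prod.snd_add, Pi.add_apply, add_mul, Finset.sum_add_distrib]
  ring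

theorem bHyp_smul_left (n : ℕ) (c : ℤ) (x z : (Fin 4 → ℤ) × (Fin n → ℤ)) :
    bHyp n (c • x) z = c * bHyp n x z := by
  unfold bHyp
  simp only [Prod.smul_fst, Prod.smul_snd, Pi.smul_apply, smul_eq_mul, mul_assoc,
    ← Finset.mul_sum]
  ring

theorem bHyp_add_right (n : ℕ) (x y z : (Fin 4 → ℤ) × (Fin n → ℤ)) :
    bHyp n z (x + y) = bHyp n z x + bHyp n z y := by
  rw [bHyp_comm, bHyp_add_left, bHyp_comm n x, bHyp_comm n y]

theorem bHyp_smul_right (n : ℕ) (c : ℤ) (x z : (Fin 4 → ℤ) × (Fin n → ℤ)) :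
    bHyp n z (c • x) = c * bHyp n z x := by
  rw [bHyp_comm, bHyp_smul_left, bHyp_comm n x]

theorem bHyp_sub_left (n : ℕ) (x y z : (Fin 4 → ℤ) × (Fin n → ℤ)) :
    bHyp n (x - y) z = bHyp n x z - bHyp n y z := by
  have := bHyp_add_left n (x - y) y z
  rw [sub_add_cancel] at this; linarith

theorem bHyp_sub_right (n : ℕ) (x y z : (Fin 4 → ℤ) × (Fin n → ℤ)) :
    bHyp n z (x - y) = bHyp n z x - bHyp n z y := by
  rw [bHyp_comm, bHyp_sub_left, bHyp_comm n x, bHyp_comm n y]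

theorem bHyp_zero_left (n : ℕ) (z : (Fin 4 → ℤ) × (Fin n → ℤ)) : bHyp n 0 z = 0 := by
  simp [bHyp]

theorem bHyp_zero_right (n : ℕ) (z : (Fin 4 → ℤ) × (Fin n → ℤ)) : bHyp n z 0 = 0 := by
  simp [bHyp]

theorem mem_LambdaD (n : ℕ) (x : (Fin 4 → ℤ) × (Fin n → ℤ)) :
    x ∈ LambdaD n ↔ 2 ∣ ∑ i, x.2 i := by
  simp [LambdaD, Ideal.mem_span_singleton]

theorem bHyp_even (n : ℕ) (x : (Fin 4 → ℤ) × (Fin n → ℤ)) (hx : x ∈ LambdaD n) :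
    2 ∣ bHyp n x x := by
  rw [mem_LambdaD] at hx
  have h : (2 : ℤ) ∣ ∑ i, (x.2 i * x.2 i - x.2 i) :=
    Finset.dvd_sum fun i _ => by
      have := Int.even_mul_pred_self (x.2 i)
      rw [mul_sub, mul_one] at this
      exact this.two_dvd
  rw [Finset.sum_sub_distrib] at h
  unfold bHyp
  have e : x.1 0 * x.1 1 + x.1 1 * x.1 0 + x.1 2 * x.1 3 + x.1 3 * x.1 2
    = 2 * (x.1 0 * x.1 1 + x.1 2 * x.1 3) := by ring
  rw [e]; omega

/-- A vector on which both positive coordinates vanish and with nonnegative norm is zero. -/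
theorem eq_zero_of_nonneg (n : ℕ) (v : (Fin 4 → ℤ) × (Fin n → ℤ))
    (h1 : v.1 0 + v.1 1 = 0) (h2 : v.1 2 + v.1 3 = 0) (h : 0 ≤ bHyp n v v) : v = 0 := by
  have e1 : v.1 1 = - v.1 0 := by linarith
  have e2 : v.1 3 = - v.1 2 := by linarith
  have hs : 0 ≤ ∑ i, v.2 i * v.2 i := Finset.sum_nonneg fun i _ => mul_self_nonneg _
  unfold bHyp at h
  rw [e1, e2] at h
  have q0 : v.1 0 = 0 := by
    by_contra hc
    have := mul_self_pos.2 hc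
    nlinarith [mul_self_nonneg (v.1 2)]
  have q2 : v.1 2 = 0 := by
    by_contra hc
    have := mul_self_pos.2 hc
    nlinarith [mul_self_nonneg (v.1 0)]
  have hz : ∑ i, v.2 i * v.2 i = 0 := by
    rw [q0, q2] at h; linarith
  rw [Finset.sum_eq_zero_iff_of_nonneg fun i _ => mul_self_nonneg _] at hz
  refine Prod.ext ?_ ?_
  · funext i
    fin_cases i
    · exact q0
    · simpa [q0] using e1
    · exact q2
    · simpa [q2] using e2
  · funext i
    simpa using hz i (Finset.mem_univ i)

theorem neg_def (n : ℕ) (e1 e2 f1 f2 x : (Fin 4 → ℤ) × (Fin n → ℤ))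
    (h11 : bHyp n e1 e1 = 0) (h12 : bHyp n e1 e2 = 0) (h22 : bHyp n e2 e2 = 0)
    (k11 : bHyp n e1 f1 = 1) (k12 : bHyp n e1 f2 = 0)
    (k21 : bHyp n e2 f1 = 0) (k22 : bHyp n e2 f2 = 1)
    (x1 : bHyp n e1 x = 0) (x2 : bHyp n e2 x = 0)
    (y1 : bHyp n f1 x = 0) (y2 : bHyp n f2 x = 0)
    (hx : x ≠ 0) : bHyp n x x < 0 := by
  by_contra hneg
  push Not at hneg
  have key : ∀ a b c : ℤ, a * (e1.1 0 + e1.1 1) + b * (e2.1 0 + e2.1 1)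
        + c * (x.1 0 + x.1 1) = 0 →
      a * (e1.1 2 + e1.1 3) + b * (e2.1 2 + e2.1 3) + c * (x.1 2 + x.1 3) = 0 →
      a • e1 + b • e2 + c • x = 0 := by
    intro a b c ha hb
    apply eq_zero_of_nonneg
    · simp; linarith
    · simp; linarith
    · simp only [bHyp_add_left, bHyp_add_right, bHyp_smul_left, bHyp_smul_right, h11, h12, h22,
        x1, x2, bHyp_comm n x e1, bHyp_comm n x e2, bHyp_comm n e2 e1]
      have := mul_nonneg (mul_self_nonneg c) hneg
      linarith
  have key2 : ∀ a b : ℤ, a * (e1.1 0 + e1.1 1) + b * (e2.1 0 + e2.1 1) = 0 →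
      a * (e1.1 2 + e1.1 3) + b * (e2.1 2 + e2.1 3) = 0 → a = 0 ∧ b = 0 := by
    intro a b ha hb
    have h := key a b 0 (by linarith) (by linarith)
    have g1 := congrArg (fun v => bHyp n v f1) h
    have g2 := congrArg (fun v => bHyp n v f2) h
    simp only [bHyp_add_left, bHyp_smul_left, bHyp_zero_left, k11, k12, k21, k22] at g1 g2
    constructor <;> linarith
  set p := e1.1 0 + e1.1 1
  set q := e1.1 2 + e1.1 3
  set r := e2.1 0 + e2.1 1
  set s := e2.1 2 + e2.1 3
  set u := x.1 0 + x.1 1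
  set w := x.1 2 + x.1 3
  have hd : p * s - q * r ≠ 0 := by
    intro hd
    obtain ⟨hr, hp⟩ := key2 r (-p) (by ring) (by linarith)
    obtain ⟨hs, hq⟩ := key2 s (-q) (by linarith) (by ring)
    have := key2 1 0 (by linarith) (by linarith)
    omega
  have h := key (r * w - s * u) (q * u - p * w) (p * s - q * r) (by ring) (by ring)
  have g1 := congrArg (fun v => bHyp n v f1) h
  have g2 := congrArg (fun v => bHyp n v f2) h
  simp only [bHyp_add_left, bHyp_smul_left, bHyp_zero_left, k11, k12, k21, k22, y1, y2,
    bHyp_comm n x f1, bHyp_comm n x f2] at g1 g2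
  have z1 : r * w - s * u = 0 := by linarith
  have z2 : q * u - p * w = 0 := by linarith
  rw [z1, z2, zero_smul, zero_smul, zero_add, zero_add] at h
  rcases smul_eq_zero.1 h with h | h
  · exact hd h
  · exact hx h

theorem finrank_LambdaD (n : ℕ) : Module.finrank ℤ (LambdaD n) = n + 4 := by
  have htot : Module.finrank ℤ ((Fin 4 → ℤ) × (Fin n → ℤ)) = n + 4 := by
    rw [Module.finrank_prod, Module.finrank_fin_fun, Module.finrank_fin_fun, add_comm]
  refine le_antisymm (htot ▸ Submodule.finrank_le _) ?_
  rw [← htot]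
  let g : ((Fin 4 → ℤ) × (Fin n → ℤ)) →ₗ[ℤ] LambdaD n :=
    LinearMap.codRestrict (LambdaD n) ((2 : ℤ) • LinearMap.id) (fun x => by
      rw [mem_LambdaD]
      exact Finset.dvd_sum fun i _ => ⟨x.2 i, by simp⟩)
  refine LinearMap.finrank_le_finrank_of_injective (f := g) ?_
  intro x y hxy
  have h : (2 : ℤ) • x = (2 : ℤ) • y := congrArg Subtype.val hxy
  exact smul_right_injective _ (two_ne_zero) h

theorem exists_frame (n : ℕ)
    (J : Submodule ℤ ((Fin 4 → ℤ) × (Fin n → ℤ)))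
    (hJΛ : J ≤ LambdaD n) (hrk : Module.finrank ℤ J = 2)
    (hiso : ∀ x ∈ J, ∀ y ∈ J, bHyp n x y = 0)
    (hsurj : ∀ φ : J →ₗ[ℤ] ℤ, ∃ x ∈ LambdaD n, ∀ v : J, φ v = bHyp n x v) :
    ∃ e1 e2 f1 f2 : (Fin 4 → ℤ) × (Fin n → ℤ),
      e1 ∈ LambdaD n ∧ e2 ∈ LambdaD n ∧ f1 ∈ LambdaD n ∧ f2 ∈ LambdaD n ∧
      (∀ x ∈ J, ∃ a b : ℤ, x = a • e1 + b • e2) ∧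
      bHyp n e1 e1 = 0 ∧ bHyp n e1 e2 = 0 ∧ bHyp n e2 e2 = 0 ∧
      bHyp n e1 f1 = 1 ∧ bHyp n e1 f2 = 0 ∧ bHyp n e2 f1 = 0 ∧ bHyp n e2 f2 = 1 ∧
      bHyp n f1 f1 = 0 ∧ bHyp n f1 f2 = 0 ∧ bHyp n f2 f2 = 0 := by
  let B := Module.finBasisOfFinrankEq ℤ J hrk
  obtain ⟨g1, hg1, h1⟩ := hsurj (B.coord 0)
  obtain ⟨g2, hg2, h2⟩ := hsurj (B.coord 1)
  obtain ⟨e1, he1⟩ : ∃ e, e = ((B 0 : J) : (Fin 4 → ℤ) × (Fin n → ℤ)) := ⟨_, rfl⟩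
  obtain ⟨e2, he2⟩ : ∃ e, e = ((B 1 : J) : (Fin 4 → ℤ) × (Fin n → ℤ)) := ⟨_, rfl⟩
  have m1 : e1 ∈ J := he1 ▸ (B 0).2
  have m2 : e2 ∈ J := he2 ▸ (B 1).2
  have a11 : bHyp n g1 e1 = 1 := by rw [he1, ← h1]; simp
  have a12 : bHyp n g1 e2 = 0 := by rw [he2, ← h1]; simp
  have a21 : bHyp n g2 e1 = 0 := by rw [he1, ← h2]; simp
  have a22 : bHyp n g2 e2 = 1 := by rw [he2, ← h2]; simp
  obtain ⟨s, hs⟩ := bHyp_even n g1 hg1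
  obtain ⟨t, ht⟩ := bHyp_even n g2 hg2
  have i11 := hiso e1 m1 e1 m1
  have i12 := hiso e1 m1 e2 m2
  have i21 := hiso e2 m2 e1 m1
  have i22 := hiso e2 m2 e2 m2
  have b11 : bHyp n e1 g1 = 1 := by rw [bHyp_comm, a11]
  have b21 : bHyp n e2 g1 = 0 := by rw [bHyp_comm, a12]
  have b12 : bHyp n e1 g2 = 0 := by rw [bHyp_comm, a21]
  have b22 : bHyp n e2 g2 = 1 := by rw [bHyp_comm, a22]
  have hc := bHyp_comm n g2 g1
  refine ⟨e1, e2, g1 - s • e1, g2 - t • e2 - (bHyp n g1 g2) • e1, hJΛ m1, hJΛ m2,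
    sub_mem hg1 (Submodule.smul_mem _ _ (hJΛ m1)),
    sub_mem (sub_mem hg2 (Submodule.smul_mem _ _ (hJΛ m2))) (Submodule.smul_mem _ _ (hJΛ m1)),
    ?_, i11, i12, i22, ?_, ?_, ?_, ?_, ?_, ?_, ?_⟩
  · intro x hx
    have := B.sum_repr ⟨x, hx⟩
    rw [Fin.sum_univ_two] at this
    refine ⟨B.repr ⟨x, hx⟩ 0, B.repr ⟨x, hx⟩ 1, ?_⟩
    rw [he1, he2]
    exact (congrArg Subtype.val this).symm
  all_goals
    simp only [bHyp_sub_left, bHyp_sub_right, bHyp_smul_left, bHyp_smul_right, a11, a12, a21, a22,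
      b11, b12, b21, b22, i11, i12, i21, i22, hs, ht, hc]
    ring

/-- If `J ⊆ Λ = U² ⊕ D_n` is a rank-2 saturated isotropic submodule such that
`Λ → Hom(J,ℤ)` is surjective, then `J` is contained in a sublattice `H ⊆ Λ` isometric
to `U ⊕ U`, and `Λ` is the internal orthogonal direct sum of `H` and its orthogonal
complement `K = H^⊥ ∩ Λ`, which is an even negative definite lattice of rank `n`. -/
theorem stmt15 (n : ℕ) (hn : 1 ≤ n)
    (J : Submodule ℤ ((Fin 4 → ℤ) × (Fin n → ℤ)))
    (hJΛ : J ≤ LambdaD n) (hrk : Module.finrank ℤ J = 2)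
    (hsat : ∀ x ∈ LambdaD n, ∀ c : ℤ, c ≠ 0 → c • x ∈ J → x ∈ J)
    (hiso : ∀ x ∈ J, ∀ y ∈ J, bHyp n x y = 0)
    (hsurj : ∀ φ : J →ₗ[ℤ] ℤ, ∃ x ∈ LambdaD n, ∀ v : J, φ v = bHyp n x v) :
    ∃ H K : Submodule ℤ ((Fin 4 → ℤ) × (Fin n → ℤ)),
      J ≤ H ∧ H ≤ LambdaD n ∧
      (∃ e : (Fin 4 → ℤ) ≃ₗ[ℤ] H, ∀ x y : Fin 4 → ℤ,
        bHyp n (↑(e x)) (↑(e y)) = bUU x y) ∧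
      (K : Set ((Fin 4 → ℤ) × (Fin n → ℤ)))
          = {y | y ∈ LambdaD n ∧ ∀ x ∈ H, bHyp n x y = 0} ∧
      H ⊔ K = LambdaD n ∧ H ⊓ K = ⊥ ∧
      Module.finrank ℤ K = n ∧
      (∀ x ∈ K, 2 ∣ bHyp n x x) ∧ (∀ x ∈ K, x ≠ 0 → bHyp n x x < 0) := by
  obtain ⟨e1, e2, f1, f2, me1, me2, mf1, mf2, hJ, i11, i12, i22, k11, k12, k21, k22, l11, l12,
    l22⟩ := exists_frame n J hJΛ hrk hiso hsurj
  have i21 : bHyp n e2 e1 = 0 := by rw [bHyp_comm, i12]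
  have l21 : bHyp n f2 f1 = 0 := by rw [bHyp_comm, l12]
  have r11 : bHyp n f1 e1 = 1 := by rw [bHyp_comm, k11]
  have r12 : bHyp n f1 e2 = 0 := by rw [bHyp_comm, k21]
  have r21 : bHyp n f2 e1 = 0 := by rw [bHyp_comm, k12]
  have r22 : bHyp n f2 e2 = 1 := by rw [bHyp_comm, k22]
  let F : (Fin 4 → ℤ) →ₗ[ℤ] (Fin 4 → ℤ) × (Fin n → ℤ) :=
    (LinearMap.proj 0).smulRight e1 + (LinearMap.proj 1).smulRight f1
      + (LinearMap.proj 2).smulRight e2 + (LinearMap.proj 3).smulRight f2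
  have hF : ∀ x, F x = x 0 • e1 + x 1 • f1 + x 2 • e2 + x 3 • f2 := fun x => rfl
  have hpair : ∀ x y, bHyp n (F x) y = x 0 * bHyp n e1 y + x 1 * bHyp n f1 y
      + x 2 * bHyp n e2 y + x 3 * bHyp n f2 y := by
    intro x y
    rw [hF]
    simp only [bHyp_add_left, bHyp_smul_left]
  have p1 : ∀ x, bHyp n (F x) e1 = x 1 := by
    intro x; rw [hpair, i11, r11, i21, r21]; ring
  have p2 : ∀ x, bHyp n (F x) f1 = x 0 := by
    intro x; rw [hpair, k11, l11, k21, l21]; ring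
  have p3 : ∀ x, bHyp n (F x) e2 = x 3 := by
    intro x; rw [hpair, i12, r12, i22, r22]; ring
  have p4 : ∀ x, bHyp n (F x) f2 = x 2 := by
    intro x; rw [hpair, k12, l12, k22, l22]; ring
  have hinj : Function.Injective F := by
    intro x y hxy
    funext i
    fin_cases i
    · exact by simpa [p2] using congrArg (fun v => bHyp n v f1) hxy
    · exact by simpa [p1] using congrArg (fun v => bHyp n v e1) hxy
    · exact by simpa [p4] using congrArg (fun v => bHyp n v f2) hxy
    · exact by simpa [p3] using congrArg (fun v => bHyp n v e2) hxy
  have hisom : ∀ x y, bHyp n (F x) (F y) = bUU x y := by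
    intro x y
    rw [hpair, bHyp_comm n e1, bHyp_comm n f1, bHyp_comm n e2, bHyp_comm n f2, p1, p2, p3, p4]
    rfl
  have hHΛ : LinearMap.range F ≤ LambdaD n := by
    rintro _ ⟨x, rfl⟩
    rw [hF]
    exact add_mem (add_mem (add_mem (Submodule.smul_mem _ _ me1) (Submodule.smul_mem _ _ mf1))
      (Submodule.smul_mem _ _ me2)) (Submodule.smul_mem _ _ mf2)
  let K : Submodule ℤ ((Fin 4 → ℤ) × (Fin n → ℤ)) :=
    { carrier := {y | y ∈ LambdaD n ∧ ∀ x ∈ LinearMap.range F, bHyp n x y = 0}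
      add_mem' := by
        rintro a b ⟨ha, ha'⟩ ⟨hb, hb'⟩
        exact ⟨add_mem ha hb, fun x hx => by rw [bHyp_add_right, ha' x hx, hb' x hx, add_zero]⟩
      zero_mem' := ⟨zero_mem _, fun x _ => bHyp_zero_right n x⟩
      smul_mem' := by
        rintro c a ⟨ha, ha'⟩
        exact ⟨Submodule.smul_mem _ _ ha, fun x hx => by
          rw [bHyp_smul_right, ha' x hx, mul_zero]⟩ }
  have hK : ∀ y, y ∈ K ↔ y ∈ LambdaD n ∧ ∀ x ∈ LinearMap.range F, bHyp n x y = 0 :=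
    fun y => Iff.rfl
  have s1 : e1 ∈ LinearMap.range F := ⟨![1, 0, 0, 0], by simp [hF]⟩
  have s2 : f1 ∈ LinearMap.range F := ⟨![0, 1, 0, 0], by simp [hF]⟩
  have s3 : e2 ∈ LinearMap.range F := ⟨![0, 0, 1, 0], by simp [hF]⟩
  have s4 : f2 ∈ LinearMap.range F := ⟨![0, 0, 0, 1], by simp [hF]⟩
  have hsup : LinearMap.range F ⊔ K = LambdaD n := by
    apply le_antisymm
    · exact sup_le hHΛ fun y hy => hy.1
    · intro y hy
      let c : Fin 4 → ℤ := ![bHyp n f1 y, bHyp n e1 y, bHyp n f2 y, bHyp n e2 y]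
      have hk : y - F c ∈ K := by
        refine ⟨sub_mem hy (hHΛ ⟨c, rfl⟩), ?_⟩
        rintro _ ⟨x, rfl⟩
        rw [bHyp_sub_right, hisom, hpair]
        simp only [bUU, c, Matrix.cons_val]
        ring
      have := add_mem (Submodule.mem_sup_left (T := K) (LinearMap.mem_range_self F c))
        (Submodule.mem_sup_right (S := LinearMap.range F) hk)
      simpa using this
  have hinf : LinearMap.range F ⊓ K = ⊥ := by
    rw [eq_bot_iff]
    rintro _ ⟨⟨x, rfl⟩, hx⟩
    have hx := hx.2
    have hz : x = 0 := by
      funext i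
      fin_cases i
      · exact by simpa [bHyp_comm n f1, p2] using hx _ s2
      · exact by simpa [bHyp_comm n e1, p1] using hx _ s1
      · exact by simpa [bHyp_comm n f2, p4] using hx _ s4
      · exact by simpa [bHyp_comm n e2, p3] using hx _ s3
    simp [hz]
  refine ⟨LinearMap.range F, K, ?_, hHΛ, ⟨LinearEquiv.ofInjective F hinj, ?_⟩, rfl, hsup, hinf,
    ?_, fun x hx => bHyp_even n x hx.1, ?_⟩
  · intro x hx
    obtain ⟨a, b, rfl⟩ := hJ x hx
    exact add_mem (Submodule.smul_mem _ _ s1) (Submodule.smul_mem _ _ s3)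
  · intro x y
    exact hisom x y
  · have hr := Submodule.rank_sup_add_rank_inf_eq (LinearMap.range F) K
    rw [hsup, hinf, rank_bot, add_zero, ← Module.finrank_eq_rank, ← Module.finrank_eq_rank,
      ← Module.finrank_eq_rank, finrank_LambdaD, LinearMap.finrank_range_of_inj hinj,
      Module.finrank_fin_fun] at hr
    have hr' : n + 4 = 4 + Module.finrank ℤ K := by exact_mod_cast hr
    omega
  · intro x hx hx0
    exact neg_def n e1 e2 f1 f2 x i11 i12 i22 k11 k12 k21 k22 (hx.2 _ s1) (hx.2 _ s3)
      (hx.2 _ s2) (hx.2 _ s4) hx0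
end

section
/- For α ∈ ℂ* and β ∈ ℂ let M(α,β) ∈ GL₄(ℂ) be the matrix with rows (1, 2β, −β², 0), (0, α, −αβ, 0), (0, 0, α², 0), (0, 0, 0, α). Then: (i) M(α,β)·M(α′,β′) = M(αα′, β′ + βα′), so that the map sending the 2×2 matrix [[1,β],[0,α]] to M(α,β) is an injective group homomorphism from the group of affine transformations of a line {[[1,β],[0,α]] : α ∈ ℂ*, β ∈ ℂ} into GL₄(ℂ); and (ii) each M(α,β) rescales the quadratic form q(x₀,x₁,x₂,x₃) = x₀x₂ + x₁², namely q(M(α,β)·x) = α²·q(x) for all x ∈ ℂ⁴. -/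
/-- The matrix `M(α,β)` with rows `(1, 2β, −β², 0)`, `(0, α, −αβ, 0)`,
`(0, 0, α², 0)`, `(0, 0, 0, α)`. -/
noncomputable def affMat (α β : ℂ) : Matrix (Fin 4) (Fin 4) ℂ :=
  !![1, 2 * β, -β ^ 2, 0;
     0, α, -(α * β), 0;
     0, 0, α ^ 2, 0;
     0, 0, 0, α]

/-- The quadratic form `q(x) = x₀x₂ + x₁²`. -/
def quadQ (x : Fin 4 → ℂ) : ℂ := x 0 * x 2 + x 1 ^ 2

/-- The stabilizer computation for the Type IV strata: `(α,β) ↦ M(α,β)` is an injective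
group homomorphism from the affine group of the line `{[[1,β],[0,α]]}` into `GL₄(ℂ)`
(multiplicativity, injectivity and invertibility below), and each `M(α,β)` rescales the
quadratic form `q = x₀x₂ + x₁²` by `α²`. -/
theorem stmt16 (α β α' β' : ℂ) (hα : α ≠ 0) (hα' : α' ≠ 0) :
    affMat α β * affMat α' β' = affMat (α * α') (β' + β * α') ∧
      (affMat α β = affMat α' β' → α = α' ∧ β = β') ∧
      IsUnit (affMat α β) ∧
      ∀ x : Fin 4 → ℂ, quadQ ((affMat α β).mulVec x) = α ^ 2 * quadQ x := by
  have hmul : ∀ a b a' b' : ℂ,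
      affMat a b * affMat a' b' = affMat (a * a') (b' + b * a') := by
    intro a b a' b'
    ext i j
    fin_cases i <;> fin_cases j <;>
      simp [affMat, Matrix.mul_apply, Fin.sum_univ_four] <;> ring
  have hone : affMat 1 0 = 1 := by
    ext i j
    fin_cases i <;> fin_cases j <;> simp [affMat]
  refine ⟨hmul _ _ _ _, ?_, ?_, ?_⟩
  · intro h
    have h1 := congrFun (congrFun h 3) 3
    have h2 := congrFun (congrFun h 0) 1
    simp [affMat] at h1 h2
    exact ⟨h1, h2⟩
  · refine ⟨⟨affMat α β, affMat α⁻¹ (-(β * α⁻¹)), ?_, ?_⟩, rfl⟩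
    · rw [hmul, mul_inv_cancel₀ hα, neg_add_cancel, hone]
    · rw [hmul, inv_mul_cancel₀ hα, ← hone]
      congr 1
      field_simp
      ring
  · intro x
    simp [quadQ, affMat, Matrix.mulVec, dotProduct, Fin.sum_univ_four]
    ring
end
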